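/- Let U ⊆ ℝ² be open and connected, let a_{ij} : U → ℝ (1 ≤ i,j ≤ 2) be smooth with a_{ij} = a_{ji} and ∑_{i,j} a_{ij}(x) ξᵢ ξⱼ > 0 for all x ∈ U and ξ ∈ ℝ² \ {0}, and let F : U × ℝ × ℝ² → ℝ be smooth with F(x, 0, 0) = 0 for all x ∈ U. Let u : U → ℝ be a smooth solution of −∑_{i,j} a_{ij}(x) (∂²u/∂xᵢ∂xⱼ)(x) + F(x, u(x), ∇u(x)) = 0 with u not identically zero. Then the critical nodal set N_crit(u) = {x ∈ U : u(x) = 0 and ∇u(x) = 0} is a discrete subset of U, i.e. each of its points is isolated in N_crit(u). -/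

import Mathlib

open MeasureTheory Metric Set Filter Topology ENNReal NNReal

noncomputable section

/-- `m`-dimensional Euclidean space. -/
abbrev Euc (m : ℕ) := EuclideanSpace ℝ (Fin m)

/-- The semilinear first-order differential operator `φ ↦ ∑ⱼ Aⱼ(x) ∂φ/∂xⱼ + V(x, φ(x))`
applied to `φ` at the point `x`. -/
def semilinApply {n N : ℕ} (A : Fin n → Euc n → Matrix (Fin N) (Fin N) ℝ)
    (V : Euc n → (Fin N → ℝ) → (Fin N → ℝ)) (φ : Euc n → (Fin N → ℝ)) (x : Euc n) :
    Fin N → ℝ :=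
  (∑ j, (A j x).mulVec (fderiv ℝ φ x (EuclideanSpace.single j 1))) + V x (φ x)

/-- Ellipticity of the principal symbol `ξ ↦ ∑ⱼ ξⱼ Aⱼ(x)` at every point of `U`. -/
def IsElliptic {n N : ℕ} (A : Fin n → Euc n → Matrix (Fin N) (Fin N) ℝ)
    (U : Set (Euc n)) : Prop :=
  ∀ x ∈ U, ∀ ξ : Euc n, ξ ≠ 0 → IsUnit (∑ j, ξ j • A j x)

/-- A set `S ⊆ ℝⁿ` is countably `m`-`C^∞`-rectifiable if it is contained in a countable
union of ranges of smooth maps `ℝᵐ → ℝⁿ`. -/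
def CountablyCinfRectifiable {n : ℕ} (m : ℕ) (S : Set (Euc n)) : Prop :=
  ∃ g : ℕ → (Euc m → Euc n), (∀ i, ContDiff ℝ (⊤ : ℕ∞) (g i)) ∧ S ⊆ ⋃ i, range (g i)

/-- The scalar semilinear second-order operator
`u ↦ −∑_{i,j} a_{ij}(x) ∂²u/∂xᵢ∂xⱼ + F(x, u(x), ∇u(x))` applied to `u` at `x`. -/
def scalarOp {n : ℕ} (a : Fin n → Fin n → Euc n → ℝ)
    (F : Euc n → ℝ → Euc n → ℝ) (u : Euc n → ℝ) (x : Euc n) : ℝ :=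
  -(∑ i, ∑ j, a i j x *
      iteratedFDeriv ℝ 2 u x ![EuclideanSpace.single i 1, EuclideanSpace.single j 1])
    + F x (u x) (gradient u x)

open scoped ContDiff ComplexConjugate FourierTransform Convolution

/-- The `j`-th partial derivative of a complex function on the plane. -/
abbrev pd (j : Fin 2) (f : Euc 2 → ℂ) (x : Euc 2) : ℂ :=
  fderiv ℝ f x (EuclideanSpace.single j 1)

lemma continuous_pd {f : Euc 2 → ℂ} (hf : ContDiff ℝ 1 f) (j : Fin 2) : Continuous (pd j f) :=
  (hf.continuous_fderiv one_ne_zero).clm_apply continuous_const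

lemma hasCompactSupport_pd {f : Euc 2 → ℂ} (hf : HasCompactSupport f) (j : Fin 2) :
    HasCompactSupport (pd j f) :=
  hf.fderiv_apply ℝ _

/-- Differentiation under the integral of a correlation along a line. -/
lemma hasDerivAt_integral_mul_conj_translate {g ψ : Euc 2 → ℂ} (hg : Continuous g)
    (hgc : HasCompactSupport g) (hψ : ContDiff ℝ 1 ψ) (hψc : HasCompactSupport ψ) (j : Fin 2) :
    HasDerivAt (fun h : ℝ => ∫ x, g x * conj (ψ (x + h • EuclideanSpace.single j 1)))
      (∫ x, g x * conj (pd j ψ x)) 0 := by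
  set v : Euc 2 := EuclideanSpace.single j 1
  obtain ⟨M, hM⟩ := (hasCompactSupport_pd hψc j).exists_bound_of_continuous (continuous_pd hψ j)
  have key := hasDerivAt_integral_of_dominated_loc_of_deriv_le (μ := volume) (x₀ := (0 : ℝ))
    (F := fun (h : ℝ) x => g x * conj (ψ (x + h • v)))
    (F' := fun (h : ℝ) x => g x * conj (pd j ψ (x + h • v)))
    (bound := fun x => ‖g x‖ * M) (s := univ) univ_mem ?_ ?_ ?_ ?_ ?_ ?_
  · simpa using key.2
  · refine Eventually.of_forall fun h => Continuous.aestronglyMeasurable ?_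
    have := hψ.continuous
    fun_prop
  · refine Continuous.integrable_of_hasCompactSupport ?_ hgc.mul_right
    have := hψ.continuous
    fun_prop
  · have := continuous_pd hψ j
    exact Continuous.aestronglyMeasurable (by fun_prop)
  · refine Eventually.of_forall fun x h _ => ?_
    simp only [norm_mul, RCLike.norm_conj]
    exact mul_le_mul_of_nonneg_left (hM _) (norm_nonneg _)
  · exact (hg.norm.integrable_of_hasCompactSupport hgc.norm).mul_const M
  · refine Eventually.of_forall fun x h _ => ?_
    have h1 : HasDerivAt (fun h : ℝ => x + h • v) v h := by
      simpa using ((hasDerivAt_id h).smul_const v).const_add x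
    have h2 : HasDerivAt (fun h : ℝ => ψ (x + h • v)) (pd j ψ (x + h • v)) h :=
      ((hψ.differentiable one_ne_zero _).hasFDerivAt).comp_hasDerivAt h h1
    exact (h2.star).const_mul (g x)

lemma integral_mul_pd_eq_neg {f g : Euc 2 → ℂ} (hf : ContDiff ℝ 1 f) (hg : ContDiff ℝ 1 g)
    (hgc : HasCompactSupport g) (j : Fin 2) :
    ∫ x, f x * pd j g x = - ∫ x, pd j f x * g x := by
  have h1 := continuous_pd hf j
  have h2 := continuous_pd hg j
  have h3 := hf.continuous
  have h4 := hg.continuous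
  refine integral_mul_fderiv_eq_neg_fderiv_mul_of_integrable ?_ ?_ ?_
    (fun x _ => hf.differentiable one_ne_zero x)
    (fun x _ => hg.differentiable one_ne_zero x)
  · exact (h1.mul h4).integrable_of_hasCompactSupport hgc.mul_left
  · exact (h3.mul h2).integrable_of_hasCompactSupport (hasCompactSupport_pd hgc j).mul_left
  · exact (h3.mul h4).integrable_of_hasCompactSupport hgc.mul_left

lemma pd_conj {f : Euc 2 → ℂ} (j : Fin 2) (x : Euc 2) :
    pd j (fun y => conj (f y)) x = conj (pd j f x) := by
  have := fderiv_star (𝕜 := ℝ) (f := f) (x := x)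
  change fderiv ℝ (fun y => star (f y)) x _ = _
  rw [this]; rfl

/-- The Jacobian of a compactly supported map of the plane integrates to zero. -/
lemma im_integral_pd_mul_conj_pd {ψ : Euc 2 → ℂ} (hψ : ContDiff ℝ 1 ψ)
    (hψc : HasCompactSupport ψ) : (∫ x, pd 0 ψ x * conj (pd 1 ψ x)).im = 0 := by
  set v : Euc 2 := EuclideanSpace.single 1 1
  set A : ℝ → ℂ := fun h => ∫ x, pd 0 ψ x * conj (ψ (x + h • v)) with hA
  have hd : HasDerivAt A (∫ x, pd 0 ψ x * conj (pd 1 ψ x)) 0 :=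
    hasDerivAt_integral_mul_conj_translate (continuous_pd hψ 0) (hasCompactSupport_pd hψc 0) hψ
      hψc 1
  have hsymm : ∀ h, A h = - conj (A (-h)) := by
    intro h
    have hT : ContDiff ℝ 1 (fun x => conj (ψ (x + h • v))) :=
      Complex.conjCLE.contDiff.comp (hψ.comp (contDiff_id.add contDiff_const))
    have e1 : A h = ∫ x, conj (ψ (x + h • v)) * pd 0 ψ x := by
      simp only [hA]; congr 1; ext x; ring
    rw [e1, integral_mul_pd_eq_neg hT hψ hψc 0, hA]
    simp only
    rw [← integral_conj]
    congr 1
    rw [← integral_add_right_eq_self _ (-(h • v))]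
    congr 1
    ext x
    rw [pd_conj]
    have : pd 0 (fun y => ψ (y + h • v)) (x + -(h • v)) = pd 0 ψ x := by
      simp only [pd]
      rw [fderiv_comp_add_right]; simp
    rw [this]; simp
  have hd2 : HasDerivAt A (conj (∫ x, pd 0 ψ x * conj (pd 1 ψ x))) 0 := by
    have h1 : HasDerivAt (fun h : ℝ => A (-h)) (-(∫ x, pd 0 ψ x * conj (pd 1 ψ x))) 0 := by
      have := HasDerivAt.scomp (𝕜 := ℝ) (0 : ℝ) (h := fun h : ℝ => -h) (h' := -1) (g₁ := A)
        (by simpa using hd) (hasDerivAt_neg _)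
      simpa [Function.comp_def] using this
    have h2 := h1.star.neg
    simp only [star_neg, neg_neg] at h2
    refine h2.congr_of_eventuallyEq (Eventually.of_forall fun h => ?_)
    rw [hsymm h]; rfl
  have := hd.unique hd2
  exact Complex.conj_eq_iff_im.mp this.symm

lemma integral_norm_sq_conj_symbol {ψ : Euc 2 → ℂ} (hψ : ContDiff ℝ 1 ψ)
    (hψc : HasCompactSupport ψ) (c : ℂ) :
    ∫ x, ‖pd 0 ψ x + conj c * pd 1 ψ x‖ ^ 2 = ∫ x, ‖pd 0 ψ x + c * pd 1 ψ x‖ ^ 2 := by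
  have h0 := continuous_pd hψ 0
  have h1 := continuous_pd hψ 1
  have c0 := hasCompactSupport_pd hψc 0
  have hX : Integrable (fun x => pd 0 ψ x * conj (pd 1 ψ x)) :=
    Continuous.integrable_of_hasCompactSupport (by fun_prop) c0.mul_right
  have hb : Integrable (fun x => ‖pd 0 ψ x + c * pd 1 ψ x‖ ^ 2) := by
    refine Continuous.integrable_of_hasCompactSupport (by fun_prop) ?_
    have : HasCompactSupport (fun x => pd 0 ψ x + c * pd 1 ψ x) :=
      c0.add (hasCompactSupport_pd hψc 1).mul_left
    exact this.comp_left (g := fun z : ℂ => ‖z‖ ^ 2) (by simp)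
  have e : ∀ x, ‖pd 0 ψ x + conj c * pd 1 ψ x‖ ^ 2 = ‖pd 0 ψ x + c * pd 1 ψ x‖ ^ 2
      - 4 * c.im * Complex.imCLM (pd 0 ψ x * conj (pd 1 ψ x)) := by
    intro x
    simp only [← Complex.normSq_eq_norm_sq, Complex.normSq_apply, Complex.imCLM_apply]
    simp only [Complex.add_re, Complex.add_im, Complex.mul_re, Complex.mul_im, Complex.conj_re,
      Complex.conj_im]
    ring
  simp only [e]
  rw [integral_sub hb ((Complex.imCLM.integrable_comp hX).const_mul _), integral_const_mul,
    Complex.imCLM.integral_comp_comm hX, Complex.imCLM_apply, im_integral_pd_mul_conj_pd hψ hψc]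
  simp

lemma integral_norm_sq_le_integral_norm_sq_pd {ψ : Euc 2 → ℂ} (hψ : ContDiff ℝ 1 ψ)
    {p : Euc 2} {R : ℝ} (hs : tsupport ψ ⊆ closedBall p R) :
    ∫ x, ‖ψ x‖ ^ 2 ≤ 4 * R ^ 2 * ∫ x, ‖pd 1 ψ x‖ ^ 2 := by
  have hψc : HasCompactSupport ψ := (isCompact_closedBall p R).of_isClosed_subset
    (isClosed_tsupport ψ) hs
  have h0 := hψ.continuous
  have h1 := continuous_pd hψ 1
  have c1 := hasCompactSupport_pd hψc 1
  set k : Euc 2 → ℂ := fun x => ((x 1 - p 1 : ℝ) : ℂ) with hk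
  have hkc : ContDiff ℝ 1 k := by
    refine Complex.ofRealCLM.contDiff.comp ?_
    exact ((EuclideanSpace.proj (𝕜 := ℝ) (1 : Fin 2)).contDiff).sub contDiff_const
  have hkd : ∀ x, pd 1 k x = 1 := by
    intro x
    have : HasFDerivAt k (Complex.ofRealCLM.comp (EuclideanSpace.proj (𝕜 := ℝ) (1 : Fin 2))) x := by
      refine Complex.ofRealCLM.hasFDerivAt.comp x ?_
      exact ((EuclideanSpace.proj (𝕜 := ℝ) (1 : Fin 2)).hasFDerivAt).sub_const _
    simp [pd, this.fderiv]
  have hn : ContDiff ℝ 1 (fun x => ψ x * conj (ψ x)) :=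
    hψ.mul (Complex.conjCLE.contDiff.comp hψ)
  have hnc : HasCompactSupport (fun x => ψ x * conj (ψ x)) := hψc.mul_right
  have hnd : ∀ x, pd 1 (fun x => ψ x * conj (ψ x)) x
      = ((2 * (ψ x * conj (pd 1 ψ x)).re : ℝ) : ℂ) := by
    intro x
    have d1 := hψ.differentiable one_ne_zero x
    have d2 : DifferentiableAt ℝ (fun x => conj (ψ x)) x :=
      (Complex.conjCLE.contDiff.comp hψ).differentiable one_ne_zero x
    have : pd 1 (fun x => ψ x * conj (ψ x)) x
        = ψ x * pd 1 (fun x => conj (ψ x)) x + conj (ψ x) * pd 1 ψ x := by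
      simp only [pd]
      rw [fderiv_fun_mul d1 d2]
      simp
    rw [this, pd_conj]
    apply Complex.ext
    · simp; ring
    · simp; ring
  have ibp := integral_mul_pd_eq_neg hkc hn hnc 1
  have hI0 : Integrable (fun x => ‖ψ x‖ ^ 2) :=
    Continuous.integrable_of_hasCompactSupport (by fun_prop)
      (hψc.comp_left (g := fun z : ℂ => ‖z‖ ^ 2) (by simp))
  have hI1 : Integrable (fun x => ‖pd 1 ψ x‖ ^ 2) :=
    Continuous.integrable_of_hasCompactSupport (by fun_prop)
      (c1.comp_left (g := fun z : ℂ => ‖z‖ ^ 2) (by simp))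
  have e1 : ∫ x, pd 1 k x * (ψ x * conj (ψ x)) = ((∫ x, ‖ψ x‖ ^ 2 : ℝ) : ℂ) := by
    rw [← integral_complex_ofReal]
    congr 1; ext x
    rw [hkd, one_mul, Complex.mul_conj, Complex.normSq_eq_norm_sq]
  have e2 : ∫ x, k x * pd 1 (fun x => ψ x * conj (ψ x)) x
      = ((∫ x, (x 1 - p 1) * (2 * (ψ x * conj (pd 1 ψ x)).re) : ℝ) : ℂ) := by
    rw [← integral_complex_ofReal]
    congr 1; ext x
    rw [hnd, hk]; push_cast; ring
  rw [e1, e2] at ibp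
  have ibp' : ∫ x, ‖ψ x‖ ^ 2 = - ∫ x, (x 1 - p 1) * (2 * (ψ x * conj (pd 1 ψ x)).re) := by
    have := congrArg Complex.re ibp
    simp only [Complex.neg_re, Complex.ofReal_re] at this
    linarith
  have hle : - ∫ x, (x 1 - p 1) * (2 * (ψ x * conj (pd 1 ψ x)).re)
      ≤ ∫ x, (1 / 2 * ‖ψ x‖ ^ 2 + 2 * R ^ 2 * ‖pd 1 ψ x‖ ^ 2) := by
    rw [← integral_neg]
    refine integral_mono ?_ ((hI0.const_mul _).add (hI1.const_mul _)) ?_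
    · refine (Continuous.integrable_of_hasCompactSupport (by fun_prop) ?_).neg
      have : HasCompactSupport (fun x => ψ x * conj (pd 1 ψ x)) := hψc.mul_right
      exact (this.comp_left (g := fun z : ℂ => 2 * z.re) (by simp)).mul_left
    · intro x
      by_cases hx : x ∈ tsupport ψ
      · have hR : ‖x 1 - p 1‖ ≤ R := by
          have h1 := PiLp.norm_apply_le (x - p) (1 : Fin 2)
          have h2 := hs hx
          rw [mem_closedBall, dist_eq_norm] at h2
          simpa using h1.trans h2
        have h3 : |(ψ x * conj (pd 1 ψ x)).re| ≤ ‖ψ x‖ * ‖pd 1 ψ x‖ := by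
          simpa using Complex.abs_re_le_norm (ψ x * conj (pd 1 ψ x))
        have h4 : -((x 1 - p 1) * (2 * (ψ x * conj (pd 1 ψ x)).re))
            ≤ R * (2 * (‖ψ x‖ * ‖pd 1 ψ x‖)) := by
          refine (neg_le_abs _).trans ?_
          rw [abs_mul, abs_mul, abs_two]
          exact mul_le_mul hR (by linarith) (by positivity) ((norm_nonneg _).trans hR)
        nlinarith [sq_nonneg (‖ψ x‖ - 2 * R * ‖pd 1 ψ x‖)]
      · have h0x : ψ x = 0 := image_eq_zero_of_notMem_tsupport hx
        simp only [h0x]; simp; positivity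
  rw [integral_add (hI0.const_mul _) (hI1.const_mul _), integral_const_mul,
    integral_const_mul] at hle
  linarith

/-- An `L²` estimate on small balls for a first-order operator `∂₀ + m ∂₁` that is a small
perturbation of an elliptic operator with constant coefficients. -/
lemma integral_norm_sq_le_of_norm_sq_pd_add_le {ψ m : Euc 2 → ℂ} (hψ : ContDiff ℝ 1 ψ)
    {p : Euc 2} {R : ℝ} (hs : tsupport ψ ⊆ closedBall p R) {μ : ℂ} (hμ : μ.im ≠ 0)
    (hm : ∀ x ∈ closedBall p R, ‖m x - μ‖ ≤ |μ.im| / 2) {G : Euc 2 → ℝ} (hG : Integrable G)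
    (hle : ∀ᵐ x, ‖pd 0 ψ x + m x * pd 1 ψ x‖ ^ 2 ≤ G x) :
    ∫ x, ‖ψ x‖ ^ 2 ≤ 16 * R ^ 2 / μ.im ^ 2 * ∫ x, G x := by
  have hψc : HasCompactSupport ψ := (isCompact_closedBall p R).of_isClosed_subset
    (isClosed_tsupport ψ) hs
  have h0 := continuous_pd hψ 0
  have h1 := continuous_pd hψ 1
  have c0 := hasCompactSupport_pd hψc 0
  have c1 := hasCompactSupport_pd hψc 1
  have hI : ∀ c : ℂ, Integrable (fun x => ‖pd 0 ψ x + c * pd 1 ψ x‖ ^ 2) := fun c => by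
    refine Continuous.integrable_of_hasCompactSupport (by fun_prop) ?_
    have : HasCompactSupport (fun x => pd 0 ψ x + c * pd 1 ψ x) := c0.add c1.mul_left
    exact this.comp_left (g := fun z : ℂ => ‖z‖ ^ 2) (by simp)
  have hI1 : Integrable (fun x => ‖pd 1 ψ x‖ ^ 2) :=
    Continuous.integrable_of_hasCompactSupport (by fun_prop)
      (c1.comp_left (g := fun z : ℂ => ‖z‖ ^ 2) (by simp))
  have hsq : 0 < μ.im ^ 2 := by positivity
  set A := ∫ x, ‖pd 0 ψ x + μ * pd 1 ψ x‖ ^ 2 with hA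
  have hB := integral_norm_sq_conj_symbol hψ hψc μ
  have e1 : μ.im ^ 2 * ∫ x, ‖pd 1 ψ x‖ ^ 2 ≤ A := by
    have : ∫ x, 2 * μ.im ^ 2 * ‖pd 1 ψ x‖ ^ 2 ≤
        ∫ x, (‖pd 0 ψ x + conj μ * pd 1 ψ x‖ ^ 2 + ‖pd 0 ψ x + μ * pd 1 ψ x‖ ^ 2) := by
      refine integral_mono (hI1.const_mul _) ((hI _).add (hI _)) fun x => ?_
      simp only [← Complex.normSq_eq_norm_sq, Complex.normSq_apply, Complex.add_re,
        Complex.add_im, Complex.mul_re, Complex.mul_im, Complex.conj_re, Complex.conj_im]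
      nlinarith [sq_nonneg ((pd 0 ψ x).re + μ.re * (pd 1 ψ x).re),
        sq_nonneg ((pd 0 ψ x).im + μ.re * (pd 1 ψ x).im)]
    rw [integral_add (hI _) (hI _), hB, integral_const_mul] at this
    linarith
  have e2 : A ≤ ∫ x, (2 * G x + μ.im ^ 2 / 2 * ‖pd 1 ψ x‖ ^ 2) := by
    refine integral_mono_ae (hI _) ((hG.const_mul _).add (hI1.const_mul _)) ?_
    filter_upwards [hle] with x hx
    by_cases hxs : x ∈ tsupport ψ
    · have h2 := hm x (hs hxs)
      have h3 : ‖pd 0 ψ x + μ * pd 1 ψ x‖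
          ≤ ‖pd 0 ψ x + m x * pd 1 ψ x‖ + |μ.im| / 2 * ‖pd 1 ψ x‖ := by
        have : pd 0 ψ x + μ * pd 1 ψ x
            = (pd 0 ψ x + m x * pd 1 ψ x) - (m x - μ) * pd 1 ψ x := by ring
        rw [this]
        refine (norm_sub_le _ _).trans ?_
        rw [norm_mul]
        gcongr
      have h4 : ‖pd 0 ψ x + μ * pd 1 ψ x‖ ^ 2
          ≤ (‖pd 0 ψ x + m x * pd 1 ψ x‖ + |μ.im| / 2 * ‖pd 1 ψ x‖) ^ 2 := by gcongr
      have h5 : (|μ.im| / 2 * ‖pd 1 ψ x‖) ^ 2 = μ.im ^ 2 / 4 * ‖pd 1 ψ x‖ ^ 2 := by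
        rw [mul_pow, div_pow, sq_abs]; ring
      nlinarith [sq_nonneg (‖pd 0 ψ x + m x * pd 1 ψ x‖ - |μ.im| / 2 * ‖pd 1 ψ x‖)]
    · have hz : fderiv ℝ ψ x = 0 := by
        by_contra h
        exact hxs (support_fderiv_subset ℝ h)
      have hG0 : 0 ≤ G x := (by positivity : (0 : ℝ) ≤ _).trans hx
      simp [pd, hz, hG0]
  rw [integral_add (hG.const_mul _) (hI1.const_mul _), integral_const_mul,
    integral_const_mul] at e2
  have e3 := integral_norm_sq_le_integral_norm_sq_pd hψ hs
  have e4 : ∫ x, ‖pd 1 ψ x‖ ^ 2 ≤ 4 / μ.im ^ 2 * ∫ x, G x := by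
    rw [div_mul_eq_mul_div, le_div_iff₀ hsq]
    linarith
  calc _ ≤ _ := e3
    _ ≤ 4 * R ^ 2 * (4 / μ.im ^ 2 * ∫ x, G x) := by gcongr
    _ = _ := by ring

/-- The symbol of `∂₀ + μ ∂₁`, up to a constant factor. -/
def symb (μ : ℂ) (ξ : Euc 2) : ℂ := (ξ 0 : ℂ) + μ * (ξ 1 : ℂ)

lemma continuous_symb (μ : ℂ) : Continuous (symb μ) := by
  unfold symb; fun_prop

lemma exists_norm_le_mul_norm_symb {μ : ℂ} (hμ : μ.im ≠ 0) :
    ∃ C > 0, ∀ ξ : Euc 2, ‖ξ‖ ≤ C * ‖symb μ ξ‖ := by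
  have hpos : 0 < |μ.im| := abs_pos.mpr hμ
  refine ⟨1 + ‖μ‖ / |μ.im| + 1 / |μ.im|, by positivity, fun ξ => ?_⟩
  have h1 : |ξ 1| ≤ ‖symb μ ξ‖ / |μ.im| := by
    rw [le_div_iff₀ hpos]
    have e : (symb μ ξ).im = μ.im * ξ 1 := by simp [symb]
    have := Complex.abs_im_le_norm (symb μ ξ)
    rw [e, abs_mul] at this
    linarith
  have h0 : |ξ 0| ≤ ‖symb μ ξ‖ + ‖μ‖ * |ξ 1| := by
    have e : ((ξ 0 : ℝ) : ℂ) = symb μ ξ - μ * (ξ 1 : ℂ) := by simp [symb]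
    have := norm_sub_le (symb μ ξ) (μ * (ξ 1 : ℂ))
    rwa [← e, norm_mul, Complex.norm_real, Complex.norm_real, Real.norm_eq_abs,
      Real.norm_eq_abs] at this
  have h2 : ‖ξ‖ ≤ |ξ 0| + |ξ 1| := by
    rw [EuclideanSpace.norm_eq, Fin.sum_univ_two]
    refine Real.sqrt_le_iff.mpr ⟨by positivity, ?_⟩
    simp only [Real.norm_eq_abs]
    nlinarith [abs_nonneg (ξ 0), abs_nonneg (ξ 1)]
  calc ‖ξ‖ ≤ |ξ 0| + |ξ 1| := h2
    _ ≤ ‖symb μ ξ‖ + ‖μ‖ * (‖symb μ ξ‖ / |μ.im|) + ‖symb μ ξ‖ / |μ.im| := by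
        gcongr
        exact h0.trans (by gcongr)
    _ = _ := by field_simp

/-- The pairing with `ξ`, as a complex-valued real-linear form. -/
def pairing (ξ : Euc 2) : Euc 2 →L[ℝ] ℂ := Complex.ofRealCLM.comp (innerSL ℝ ξ)

lemma pairing_apply (ξ x : Euc 2) : pairing ξ x = ((inner ℝ ξ x : ℝ) : ℂ) := rfl

lemma pairing_single (ξ : Euc 2) (j : Fin 2) :
    pairing ξ (EuclideanSpace.single j 1) = (ξ j : ℂ) := by
  simp [pairing_apply, EuclideanSpace.inner_single_right]

lemma continuous_pairing : Continuous pairing := by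
  unfold pairing
  exact continuous_const.clm_comp (innerSL ℝ).continuous

lemma norm_pairing_le (ξ : Euc 2) : ‖pairing ξ‖ ≤ ‖ξ‖ := by
  refine ContinuousLinearMap.opNorm_le_bound _ (norm_nonneg _) fun x => ?_
  rw [pairing_apply, Complex.norm_real]
  exact norm_inner_le_norm ξ x

/-- The character `x ↦ exp (-2πi⟨ξ, x⟩)`. -/
def wave (x ξ : Euc 2) : ℂ :=
  Complex.exp (((-2 * Real.pi * inner ℝ ξ x : ℝ) : ℂ) * Complex.I)

lemma norm_wave (x ξ : Euc 2) : ‖wave x ξ‖ = 1 := Complex.norm_exp_ofReal_mul_I _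

lemma continuous_wave_left (ξ : Euc 2) : Continuous fun x => wave x ξ := by
  unfold wave; fun_prop

lemma continuous_wave_right (x : Euc 2) : Continuous (wave x) := by
  unfold wave; fun_prop

lemma norm_wave_sub_one_le (x ξ : Euc 2) : ‖wave x ξ - 1‖ ≤ 2 * Real.pi * (‖ξ‖ * ‖x‖) := by
  have h := Real.norm_exp_I_mul_ofReal_sub_one_le (x := (-2 * Real.pi * inner ℝ ξ x : ℝ))
  rw [mul_comm Complex.I] at h
  refine h.trans ?_
  rw [norm_mul, Real.norm_eq_abs, abs_mul, abs_neg, abs_two, abs_of_pos Real.pi_pos]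
  gcongr
  exact norm_inner_le_norm (𝕜 := ℝ) ξ x

lemma fourier_eq_integral_wave (c : Euc 2 → ℂ) (x : Euc 2) :
    𝓕 c x = ∫ ξ, wave x ξ * c ξ := by
  rw [Real.fourier_eq']; rfl

lemma hasFDerivAt_wave (x ξ : Euc 2) :
    HasFDerivAt (fun y => wave y ξ)
      ((wave x ξ * (-2 * Real.pi * Complex.I)) • pairing ξ) x := by
  have h1 : HasFDerivAt (fun y : Euc 2 => ((-2 * Real.pi * inner ℝ ξ y : ℝ) : ℂ) * Complex.I)
      ((-2 * Real.pi * Complex.I : ℂ) • pairing ξ) x := by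
    refine ((-2 * Real.pi * Complex.I : ℂ) • pairing ξ).hasFDerivAt.congr_of_eventuallyEq
      (Eventually.of_forall fun y => ?_)
    simp only [smul_apply, pairing_apply, smul_eq_mul]
    push_cast; ring
  have h2 := h1.cexp
  rw [smul_smul] at h2
  exact h2

/-- The inverse Fourier multiplier `1 / symb μ` applied to `c`, evaluated at `x` after
subtracting its value at the origin. -/
def antiIntegrand (μ : ℂ) (c : Euc 2 → ℂ) (x ξ : Euc 2) : ℂ :=
  (wave x ξ - 1) * ((-2 * Real.pi * Complex.I)⁻¹ * (symb μ ξ)⁻¹ * c ξ)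

/-- The derivative of `antiIntegrand` in `x`. -/
def antiIntegrandDeriv (μ : ℂ) (c : Euc 2 → ℂ) (x ξ : Euc 2) : Euc 2 →L[ℝ] ℂ :=
  (wave x ξ * (symb μ ξ)⁻¹ * c ξ) • pairing ξ

section antiderivative

variable {μ : ℂ} {C : ℝ} {c : Euc 2 → ℂ}

lemma norm_inv_symb_mul_norm_le (hC : ∀ ξ : Euc 2, ‖ξ‖ ≤ C * ‖symb μ ξ‖) (ξ : Euc 2) :
    ‖(symb μ ξ)⁻¹‖ * ‖ξ‖ ≤ C := by
  rcases eq_or_ne (symb μ ξ) 0 with h | h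
  · have h1 : symb μ (EuclideanSpace.single 0 1) = 1 := by simp [symb]
    have h2 := hC (EuclideanSpace.single 0 1)
    rw [h1, norm_one, mul_one] at h2
    simpa [h] using (norm_nonneg _).trans h2
  · rw [norm_inv, inv_mul_le_iff₀ (norm_pos_iff.mpr h), mul_comm]
    exact hC ξ

lemma norm_antiIntegrandDeriv_le (hC : ∀ ξ : Euc 2, ‖ξ‖ ≤ C * ‖symb μ ξ‖) (x ξ : Euc 2) :
    ‖antiIntegrandDeriv μ c x ξ‖ ≤ C * ‖c ξ‖ := by
  rw [antiIntegrandDeriv, norm_smul, norm_mul, norm_mul, norm_wave, one_mul]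
  calc ‖(symb μ ξ)⁻¹‖ * ‖c ξ‖ * ‖pairing ξ‖ ≤ ‖(symb μ ξ)⁻¹‖ * ‖c ξ‖ * ‖ξ‖ := by
        gcongr; exact norm_pairing_le ξ
    _ = (‖(symb μ ξ)⁻¹‖ * ‖ξ‖) * ‖c ξ‖ := by ring
    _ ≤ _ := by gcongr; exact norm_inv_symb_mul_norm_le hC ξ

lemma norm_antiIntegrand_le (hC : ∀ ξ : Euc 2, ‖ξ‖ ≤ C * ‖symb μ ξ‖) (x ξ : Euc 2) :
    ‖antiIntegrand μ c x ξ‖ ≤ C * ‖x‖ * ‖c ξ‖ := by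
  have h3 : ‖(-2 * Real.pi * Complex.I : ℂ)⁻¹‖ = (2 * Real.pi)⁻¹ := by
    simp [abs_of_pos Real.pi_pos, mul_comm]
  rw [antiIntegrand, norm_mul, norm_mul, norm_mul, h3]
  calc ‖wave x ξ - 1‖ * ((2 * Real.pi)⁻¹ * ‖(symb μ ξ)⁻¹‖ * ‖c ξ‖)
      ≤ (2 * Real.pi * (‖ξ‖ * ‖x‖)) * ((2 * Real.pi)⁻¹ * ‖(symb μ ξ)⁻¹‖ * ‖c ξ‖) := by
        gcongr; exact norm_wave_sub_one_le x ξ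
    _ = (‖(symb μ ξ)⁻¹‖ * ‖ξ‖) * ‖x‖ * ‖c ξ‖ := by field_simp
    _ ≤ _ := by gcongr; exact norm_inv_symb_mul_norm_le hC ξ

lemma measurable_inv_symb : Measurable fun ξ => (symb μ ξ)⁻¹ :=
  (continuous_symb μ).measurable.inv

lemma aestronglyMeasurable_antiIntegrand (hc : Integrable c) (x : Euc 2) :
    AEStronglyMeasurable (antiIntegrand μ c x) :=
  (((continuous_wave_right x).measurable.sub_const 1).aestronglyMeasurable).mul
    ((measurable_inv_symb.const_mul _).aestronglyMeasurable.mul hc.1)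

lemma aestronglyMeasurable_antiIntegrandDeriv (hc : Integrable c) (x : Euc 2) :
    AEStronglyMeasurable (antiIntegrandDeriv μ c x) :=
  (((continuous_wave_right x).measurable.mul measurable_inv_symb).aestronglyMeasurable.mul
    hc.1).smul continuous_pairing.aestronglyMeasurable

lemma integrable_antiIntegrand (hC : ∀ ξ : Euc 2, ‖ξ‖ ≤ C * ‖symb μ ξ‖) (hc : Integrable c)
    (x : Euc 2) : Integrable (antiIntegrand μ c x) :=
  (hc.norm.const_mul (C * ‖x‖)).mono' (aestronglyMeasurable_antiIntegrand hc x)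
    (Eventually.of_forall (norm_antiIntegrand_le hC x))

lemma integrable_antiIntegrandDeriv (hC : ∀ ξ : Euc 2, ‖ξ‖ ≤ C * ‖symb μ ξ‖)
    (hc : Integrable c) (x : Euc 2) : Integrable (antiIntegrandDeriv μ c x) :=
  (hc.norm.const_mul C).mono' (aestronglyMeasurable_antiIntegrandDeriv hc x)
    (Eventually.of_forall (norm_antiIntegrandDeriv_le hC x))

lemma hasFDerivAt_antiIntegrand (x ξ : Euc 2) :
    HasFDerivAt (fun y => antiIntegrand μ c y ξ) (antiIntegrandDeriv μ c x ξ) x := by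
  have h2 := ((hasFDerivAt_wave x ξ).sub_const 1).mul_const
      ((-2 * Real.pi * Complex.I)⁻¹ * (symb μ ξ)⁻¹ * c ξ)
  refine h2.congr_fderiv ?_
  have hpi : (-2 * Real.pi * Complex.I : ℂ) ≠ 0 := by simp [Real.pi_ne_zero]
  rw [antiIntegrandDeriv, smul_smul]
  congr 1
  field_simp

lemma hasFDerivAt_integral_antiIntegrand (hC : ∀ ξ : Euc 2, ‖ξ‖ ≤ C * ‖symb μ ξ‖)
    (hc : Integrable c) (x : Euc 2) :
    HasFDerivAt (fun y => ∫ ξ, antiIntegrand μ c y ξ) (∫ ξ, antiIntegrandDeriv μ c x ξ) x :=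
  hasFDerivAt_integral_of_dominated_of_fderiv_le (s := univ) univ_mem
    (Eventually.of_forall (aestronglyMeasurable_antiIntegrand hc))
    (integrable_antiIntegrand hC hc x) (aestronglyMeasurable_antiIntegrandDeriv hc x)
    (Eventually.of_forall fun ξ y _ => norm_antiIntegrandDeriv_le hC y ξ) (hc.norm.const_mul C)
    (Eventually.of_forall fun ξ y _ => hasFDerivAt_antiIntegrand y ξ)

lemma continuous_integral_antiIntegrandDeriv (hC : ∀ ξ : Euc 2, ‖ξ‖ ≤ C * ‖symb μ ξ‖)
    (hc : Integrable c) : Continuous fun x => ∫ ξ, antiIntegrandDeriv μ c x ξ := by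
  refine continuous_of_dominated (aestronglyMeasurable_antiIntegrandDeriv hc)
    (fun x => Eventually.of_forall (norm_antiIntegrandDeriv_le hC x)) (hc.norm.const_mul C)
    (Eventually.of_forall fun ξ => ?_)
  simp only [antiIntegrandDeriv]
  exact (((continuous_wave_left ξ).mul_const _).mul_const _).smul continuous_const

lemma integral_antiIntegrandDeriv_single (hC : ∀ ξ : Euc 2, ‖ξ‖ ≤ C * ‖symb μ ξ‖)
    (hc : Integrable c) (x : Euc 2) (j : Fin 2) :
    (∫ ξ, antiIntegrandDeriv μ c x ξ) (EuclideanSpace.single j 1)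
      = 𝓕 (fun ξ => (ξ j : ℂ) / symb μ ξ * c ξ) x := by
  rw [ContinuousLinearMap.integral_apply (integrable_antiIntegrandDeriv hC hc x),
    fourier_eq_integral_wave]
  congr 1; ext ξ
  rw [antiIntegrandDeriv, smul_apply, pairing_single, smul_eq_mul]
  ring

lemma norm_multiplier_mul_le (hC : ∀ ξ : Euc 2, ‖ξ‖ ≤ C * ‖symb μ ξ‖) (j : Fin 2) (ξ : Euc 2) :
    ‖(ξ j : ℂ) / symb μ ξ * c ξ‖ ≤ C * ‖c ξ‖ := by
  rw [norm_mul, div_eq_mul_inv, norm_mul, Complex.norm_real]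
  gcongr
  rw [mul_comm]
  refine le_trans ?_ (norm_inv_symb_mul_norm_le hC ξ)
  gcongr
  exact PiLp.norm_apply_le ξ j

lemma integrable_multiplier_mul (hC : ∀ ξ : Euc 2, ‖ξ‖ ≤ C * ‖symb μ ξ‖) (hc : Integrable c)
    (j : Fin 2) : Integrable fun ξ => (ξ j : ℂ) / symb μ ξ * c ξ := by
  refine (hc.norm.const_mul C).mono' ?_ (Eventually.of_forall (norm_multiplier_mul_le hC j))
  refine AEStronglyMeasurable.mul (Measurable.aestronglyMeasurable ?_) hc.1
  refine Measurable.div (Continuous.measurable ?_) (continuous_symb μ).measurable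
  fun_prop

lemma fourier_multiplier_add (hC : ∀ ξ : Euc 2, ‖ξ‖ ≤ C * ‖symb μ ξ‖) (hc : Integrable c)
    (x : Euc 2) :
    𝓕 (fun ξ => (ξ 0 : ℂ) / symb μ ξ * c ξ) x + μ * 𝓕 (fun ξ => (ξ 1 : ℂ) / symb μ ξ * c ξ) x
      = 𝓕 c x := by
  have hi : ∀ j : Fin 2, Integrable fun ξ => wave x ξ * ((ξ j : ℂ) / symb μ ξ * c ξ) := fun j =>
    (integrable_multiplier_mul hC hc j).bdd_mul (continuous_wave_right x).aestronglyMeasurable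
      (Eventually.of_forall fun ξ => (norm_wave x ξ).le)
  rw [fourier_eq_integral_wave, fourier_eq_integral_wave, fourier_eq_integral_wave,
    ← integral_const_mul, ← integral_add (hi 0) ((hi 1).const_mul μ)]
  refine integral_congr_ae ?_
  filter_upwards [compl_mem_ae_iff.mpr (measure_singleton (μ := volume) (0 : Euc 2))] with ξ hξ
  have hs : symb μ ξ ≠ 0 := by
    intro h
    have := hC ξ
    rw [h, norm_zero, mul_zero] at this
    exact hξ (norm_le_zero_iff.mp this)
  have : wave x ξ * ((ξ 0 : ℂ) / symb μ ξ * c ξ) + μ * (wave x ξ * ((ξ 1 : ℂ) / symb μ ξ * c ξ))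
      = wave x ξ * ((symb μ ξ) / symb μ ξ * c ξ) := by
    conv_rhs => rw [show symb μ ξ / symb μ ξ = ((ξ 0 : ℂ) + μ * (ξ 1 : ℂ)) / symb μ ξ from rfl]
    ring
  simp only [this, div_self hs, one_mul]

end antiderivative

lemma integral_norm_convolution_le {f g : Euc 2 → ℂ} (hf : Integrable f) (hg : Integrable g) :
    ∫ x, ‖(f ⋆[ContinuousLinearMap.mul ℂ ℂ] g) x‖ ≤ (∫ x, ‖f x‖) * ∫ x, ‖g x‖ := by
  have h := integral_convolution (ContinuousLinearMap.mul ℝ ℝ) (μ := volume) (ν := volume)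
    hf.norm hg.norm
  rw [ContinuousLinearMap.mul_apply'] at h
  rw [← h]
  refine integral_mono (hf.integrable_convolution _ hg).norm
    (hf.norm.integrable_convolution _ hg.norm) fun x => ?_
  rw [convolution_def, convolution_def]
  refine (norm_integral_le_integral_norm _).trans (le_of_eq ?_)
  simp

lemma convolution_sub_ae_eq {f g h : Euc 2 → ℂ} (hf : Integrable f) (hg : Integrable g)
    (hh : Integrable h) :
    f ⋆[ContinuousLinearMap.mul ℂ ℂ] (fun x => g x - h x) =ᵐ[volume]
      fun x => (f ⋆[ContinuousLinearMap.mul ℂ ℂ] g) x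
        - (f ⋆[ContinuousLinearMap.mul ℂ ℂ] h) x := by
  filter_upwards [hf.ae_convolution_exists (ContinuousLinearMap.mul ℂ ℂ) hg,
    hf.ae_convolution_exists (ContinuousLinearMap.mul ℂ ℂ) hh] with x h1 h2
  simp only [convolution_def, map_sub]
  exact integral_sub h1 h2

/-- The integral equation `c = b - b ⋆ (κ c)` is solvable in `L¹` for small `b`. -/
lemma exists_integrable_ae_eq_sub_convolution {κ b : Euc 2 → ℂ} {C : ℝ}
    (hκ : ∀ g : Euc 2 → ℂ, Integrable g → Integrable fun ξ => κ ξ * g ξ)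
    (hκC : ∀ ξ, ‖κ ξ‖ ≤ C) (hb : Integrable b) (hbC : C * ∫ ξ, ‖b ξ‖ ≤ 1 / 2) :
    ∃ c : Euc 2 → ℂ, Integrable c ∧ ∫ ξ, ‖c ξ‖ ≤ 2 * ∫ ξ, ‖b ξ‖ ∧
      c =ᵐ[volume]
        fun ξ => b ξ - (b ⋆[ContinuousLinearMap.mul ℂ ℂ] (fun η => κ η * c η)) ξ := by
  have hC0 : 0 ≤ C := (norm_nonneg _).trans (hκC 0)
  have hI : ∀ g : Euc 2 → ℂ, Integrable g →
      Integrable (b ⋆[ContinuousLinearMap.mul ℂ ℂ] (fun η => κ η * g η)) := fun g hg =>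
    hb.integrable_convolution _ (hκ g hg)
  have hconv : ∀ g : Euc 2 → ℂ, Integrable g →
      ∫ ξ, ‖(b ⋆[ContinuousLinearMap.mul ℂ ℂ] (fun η => κ η * g η)) ξ‖
        ≤ (1 / 2) * ∫ ξ, ‖g ξ‖ := by
    intro g hg
    refine (integral_norm_convolution_le hb (hκ g hg)).trans ?_
    have h1 : ∫ ξ, ‖κ ξ * g ξ‖ ≤ C * ∫ ξ, ‖g ξ‖ := by
      rw [← integral_const_mul]
      refine integral_mono (hκ g hg).norm (hg.norm.const_mul C) fun ξ => ?_
      simp only [norm_mul]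
      gcongr
      exact hκC ξ
    calc _ ≤ (∫ ξ, ‖b ξ‖) * (C * ∫ ξ, ‖g ξ‖) := by gcongr
      _ = (C * ∫ ξ, ‖b ξ‖) * ∫ ξ, ‖g ξ‖ := by ring
      _ ≤ _ := by gcongr
  have hTi : ∀ g : Euc 2 →₁[volume] ℂ,
      Integrable fun ξ => b ξ - (b ⋆[ContinuousLinearMap.mul ℂ ℂ] (fun η => κ η * g η)) ξ :=
    fun g => hb.sub (hI g (L1.integrable_coeFn g))
  set T : (Euc 2 →₁[volume] ℂ) → (Euc 2 →₁[volume] ℂ) := fun g => (hTi g).toL1 with hT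
  have hTc : ContractingWith (1 / 2) T := by
    refine ⟨by rw [div_lt_one two_pos]; exact one_lt_two, LipschitzWith.of_dist_le_mul
      fun g h => ?_⟩
    rw [dist_eq_norm, dist_eq_norm, hT, ← Integrable.toL1_sub, L1.norm_of_fun_eq_integral_norm,
      L1.norm_eq_integral_norm]
    have hgi := L1.integrable_coeFn g
    have hhi := L1.integrable_coeFn h
    have e1 : ∫ ξ, ‖(g - h) ξ‖ = ∫ ξ, ‖g ξ - h ξ‖ :=
      integral_congr_ae (by
        filter_upwards [Lp.coeFn_sub g h] with ξ hξ; rw [hξ, Pi.sub_apply])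
    rw [e1]
    refine le_trans (le_of_eq (integral_congr_ae ?_)) (hconv _ (hgi.sub hhi))
    filter_upwards [convolution_sub_ae_eq hb (hκ _ hgi) (hκ _ hhi)] with ξ hξ
    simp only [Pi.sub_apply, mul_sub, hξ]
    rw [← norm_neg]
    congr 1
    ring
  obtain ⟨c, hc⟩ : ∃ c, T c = c := ⟨_, hTc.fixedPoint_isFixedPt⟩
  have hci := L1.integrable_coeFn c
  have hae : c =ᵐ[volume]
      fun ξ => b ξ - (b ⋆[ContinuousLinearMap.mul ℂ ℂ] (fun η => κ η * c η)) ξ := by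
    have := (hTi c).coeFn_toL1
    rwa [show (hTi c).toL1 = c from hc] at this
  refine ⟨c, hci, ?_, hae⟩
  have h1 : ∫ ξ, ‖c ξ‖ ≤ (∫ ξ, ‖b ξ‖) + (1 / 2) * ∫ ξ, ‖c ξ‖ := by
    refine le_trans ?_ (add_le_add_right (hconv c hci) _)
    rw [← integral_add hb.norm (hI c hci).norm]
    refine integral_mono_ae hci.norm (hb.norm.add (hI c hci).norm) ?_
    filter_upwards [hae] with ξ hξ
    rw [hξ]
    exact norm_sub_le _ _
  linarith

/-- Almost constant complex structures that are small perturbations in the Wiener algebra have a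
bi-Lipschitz first integral. -/
lemma exists_bilipschitz_beltrami_of_small {μ : ℂ} (hμ : μ.im ≠ 0) :
    ∃ δ > 0, ∃ m > 0, ∃ M, ∀ b : Euc 2 → ℂ, Integrable b → ∫ ξ, ‖b ξ‖ < δ →
      ∃ f : Euc 2 → ℂ, ContDiff ℝ 1 f ∧
        (∀ x, pd 0 f x + (μ + 𝓕 b x) * pd 1 f x = 0) ∧
        ∀ x y, m * ‖x - y‖ ≤ ‖f x - f y‖ ∧ ‖f x - f y‖ ≤ M * ‖x - y‖ := by
  obtain ⟨C, hC0, hC⟩ := exists_norm_le_mul_norm_symb hμ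
  -- the linear first integral of the constant structure
  set ℓ : Euc 2 →L[ℝ] ℂ := μ • pairing (EuclideanSpace.single 0 1)
    - pairing (EuclideanSpace.single 1 1) with hℓ
  have hℓa : ∀ x, ℓ x = μ * (x 0 : ℂ) - (x 1 : ℂ) := fun x => by
    simp [hℓ, pairing_apply, EuclideanSpace.inner_single_left]
  obtain ⟨m, hm, hml⟩ : ∃ m > 0, ∀ x, m * ‖x‖ ≤ ‖ℓ x‖ := by
    have hμ' : (-μ⁻¹).im ≠ 0 := by
      have : μ ≠ 0 := fun h => hμ (by simp [h])
      simp [hμ, this, Complex.inv_im]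
    obtain ⟨D, hD0, hD⟩ := exists_norm_le_mul_norm_symb hμ'
    have h0 : μ ≠ 0 := fun h => hμ (by simp [h])
    refine ⟨‖μ‖ / D, by positivity, fun x => ?_⟩
    have : ℓ x = μ * symb (-μ⁻¹) x := by
      rw [hℓa, symb]; field_simp; ring
    rw [this, norm_mul, div_mul_eq_mul_div, div_le_iff₀ hD0, mul_assoc]
    gcongr
    rw [mul_comm]; exact hD x
  refine ⟨min (1 / (2 * C)) (m / (4 * C)), by positivity, m / 2, by positivity, ‖ℓ‖ + m / 2,
    fun b hb hbδ => ?_⟩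
  have hb1 : C * ∫ ξ, ‖b ξ‖ ≤ 1 / 2 := by
    have := hbδ.le.trans (min_le_left _ _)
    rw [le_div_iff₀ (by positivity)] at this
    linarith
  have hb2 : C * (2 * ∫ ξ, ‖b ξ‖) ≤ m / 2 := by
    have := hbδ.le.trans (min_le_right _ _)
    rw [le_div_iff₀ (by positivity)] at this
    linarith
  obtain ⟨c, hci, hcn, hae⟩ := exists_integrable_ae_eq_sub_convolution
    (κ := fun ξ => (ξ 1 : ℂ) / symb μ ξ) (fun g hg => integrable_multiplier_mul hC hg 1)
    (fun ξ => by simpa using norm_multiplier_mul_le (c := fun _ => 1) hC 1 ξ) hb hb1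
  set V : Euc 2 → ℂ := fun x => ∫ ξ, antiIntegrand μ c x ξ with hV
  set V' : Euc 2 → (Euc 2 →L[ℝ] ℂ) := fun x => ∫ ξ, antiIntegrandDeriv μ c x ξ with hV'
  have hVd : ∀ x, HasFDerivAt V (V' x) x := hasFDerivAt_integral_antiIntegrand hC hci
  have hV'n : ∀ x, ‖V' x‖ ≤ m / 2 := fun x => by
    refine (norm_integral_le_of_norm_le (hci.norm.const_mul C)
      (Eventually.of_forall (norm_antiIntegrandDeriv_le hC x))).trans ?_
    rw [integral_const_mul]
    exact le_trans (by gcongr) hb2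
  have hVlip : ∀ x y, ‖V x - V y‖ ≤ m / 2 * ‖x - y‖ := fun x y =>
    convex_univ.norm_image_sub_le_of_norm_hasFDerivWithin_le
      (fun z _ => (hVd z).hasFDerivWithinAt) (fun z _ => hV'n z) (mem_univ y) (mem_univ x)
  have hfd : ∀ x, HasFDerivAt (fun x => ℓ x + V x) (ℓ + V' x) x := fun x =>
    ℓ.hasFDerivAt.add (hVd x)
  refine ⟨fun x => ℓ x + V x, ?_, fun x => ?_, fun x y => ?_⟩
  · rw [contDiff_one_iff_fderiv]
    refine ⟨fun x => (hfd x).differentiableAt, ?_⟩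
    rw [funext fun x => (hfd x).fderiv]
    exact continuous_const.add (continuous_integral_antiIntegrandDeriv hC hci)
  · have e0 : V' x (EuclideanSpace.single 0 1) = _ :=
      integral_antiIntegrandDeriv_single hC hci x 0
    have e1 : V' x (EuclideanSpace.single 1 1) = _ :=
      integral_antiIntegrandDeriv_single hC hci x 1
    have e2 := fourier_multiplier_add hC hci x
    have e3 : 𝓕 c x = 𝓕 b x - 𝓕 b x * 𝓕 (fun ξ => (ξ 1 : ℂ) / symb μ ξ * c ξ) x := by
      rw [← Real.fourier_mul_convolution_eq hb (integrable_multiplier_mul hC hci 1),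
        fourier_eq_integral_wave c, fourier_eq_integral_wave b, fourier_eq_integral_wave,
        ← integral_sub]
      · refine integral_congr_ae ?_
        filter_upwards [hae] with ξ hξ
        rw [← mul_sub]
        congr 1
      all_goals
        refine Integrable.bdd_mul ?_ (continuous_wave_right x).aestronglyMeasurable
          (Eventually.of_forall fun ξ => (norm_wave x ξ).le)
      · exact hb
      · exact hb.integrable_convolution _ (integrable_multiplier_mul hC hci 1)
    have h0 : ℓ (EuclideanSpace.single 0 1) = μ := by rw [hℓa]; simp
    have h1 : ℓ (EuclideanSpace.single 1 1) = -1 := by rw [hℓa]; simp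
    simp only [pd, (hfd x).fderiv, add_apply, h0, h1]
    rw [e0, e1]
    linear_combination e2 + e3
  · have e : ℓ x + V x - (ℓ y + V y) = ℓ (x - y) + (V x - V y) := by rw [map_sub]; ring
    rw [e]
    constructor
    · have := norm_sub_norm_le (ℓ (x - y)) (-(V x - V y))
      rw [sub_neg_eq_add, norm_neg] at this
      linarith [hml (x - y), hVlip x y]
    · refine (norm_add_le _ _).trans ?_
      linarith [ℓ.le_opNorm (x - y), hVlip x y]

lemma exists_forall_norm_iteratedFDeriv_le {g : Euc 2 → ℂ} (hg : ContDiff ℝ ∞ g)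
    (hs : HasCompactSupport g) (N : ℕ) :
    ∃ A, 0 ≤ A ∧ ∀ n ≤ N, ∀ y, ‖iteratedFDeriv ℝ n g y‖ ≤ A := by
  have h : ∀ n : ℕ, ∃ A, ∀ y, ‖iteratedFDeriv ℝ n g y‖ ≤ A := fun n =>
    (hs.iteratedFDeriv n).exists_bound_of_continuous
      (hg.continuous_iteratedFDeriv (by exact_mod_cast le_top))
  choose A hA using h
  refine ⟨∑ n ∈ Finset.range (N + 1), A n,
    Finset.sum_nonneg fun n _ => (norm_nonneg _).trans (hA n 0), fun n hn y => (hA n y).trans ?_⟩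
  exact Finset.single_le_sum (f := A) (fun n _ => (norm_nonneg _).trans (hA n 0))
    (Finset.mem_range.mpr (by omega))

/-- A function with small derivatives up to order three and support in a fixed ball is small in the
Wiener algebra. -/
lemma exists_fourier_eq_of_norm_iteratedFDeriv_le :
    ∃ K > 0, ∀ (g : Euc 2 → ℂ) (ε : ℝ), ContDiff ℝ ∞ g → tsupport g ⊆ closedBall 0 2 →
      (∀ n ≤ 3, ∀ y, ‖iteratedFDeriv ℝ n g y‖ ≤ ε) →
      ∃ b : Euc 2 → ℂ, Integrable b ∧ ∫ ξ, ‖b ξ‖ ≤ K * ε ∧ 𝓕 b = g := by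
  have hI : Integrable fun ξ : Euc 2 => (1 + ‖ξ‖) ^ (-(3 : ℝ)) :=
    integrable_one_add_norm (by simp; norm_num)
  set J := ∫ ξ : Euc 2, (1 + ‖ξ‖) ^ (-(3 : ℝ)) with hJ
  have hJ0 : 0 ≤ J := integral_nonneg fun ξ => by positivity
  set v := volume.real (closedBall (0 : Euc 2) 2) with hv
  have hv0 : 0 ≤ v := measureReal_nonneg
  refine ⟨144 * v * J + 1, by positivity, fun g ε hg hs hε => ?_⟩
  have hε0 : 0 ≤ ε := (norm_nonneg _).trans (hε 0 (by norm_num) 0)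
  have hcs : HasCompactSupport g := (isCompact_closedBall 0 2).of_isClosed_subset
    (isClosed_tsupport g) hs
  have hintg : ∀ k n : ℕ, Integrable fun y => ‖y‖ ^ k * ‖iteratedFDeriv ℝ n g y‖ := fun k n => by
    refine Continuous.integrable_of_hasCompactSupport ?_ ((hcs.iteratedFDeriv n).norm.mul_left)
    exact (continuous_norm.pow k).mul
      (hg.continuous_iteratedFDeriv (by exact_mod_cast le_top)).norm
  have hsm : ∀ n ≤ 3, ∫ y, ‖y‖ ^ 0 * ‖iteratedFDeriv ℝ n g y‖ ≤ v * ε := by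
    intro n hn
    simp only [pow_zero, one_mul]
    rw [← setIntegral_eq_integral_of_forall_compl_eq_zero (s := closedBall (0 : Euc 2) 2)]
    · have hfin : volume (closedBall (0 : Euc 2) 2) < ⊤ := measure_closedBall_lt_top
      have h := norm_setIntegral_le_of_norm_le_const
        (f := fun y => ‖iteratedFDeriv ℝ n g y‖) hfin fun y _ =>
          (norm_norm (iteratedFDeriv ℝ n g y)).le.trans (hε n hn y)
      rw [mul_comm]
      exact (le_abs_self _).trans h
    · intro y hy
      rw [norm_eq_zero]
      by_contra h
      exact hy (hs (support_iteratedFDeriv_subset n h))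
  have hdec : ∀ n : ℕ, n ≤ 3 → ∀ ξ, ‖ξ‖ ^ n * ‖𝓕 g ξ‖ ≤ 2 ^ n * ((n + 1) * (v * ε)) := by
    intro n hn ξ
    have h := Real.pow_mul_norm_iteratedFDeriv_fourier_le (K := ⊤) (N := ⊤) hg
      (fun k n _ _ => hintg k n) (k := 0) (n := n) le_top le_top ξ
    rw [norm_iteratedFDeriv_zero] at h
    refine h.trans ?_
    simp only [pow_zero, one_mul, Nat.cast_zero, mul_zero, zero_add]
    gcongr
    rw [Finset.sum_product]
    simp only [Finset.range_one, Finset.sum_singleton]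
    calc _ ≤ ∑ j ∈ Finset.range (n + 1), v * ε :=
          Finset.sum_le_sum fun j hj => hsm j (by have := Finset.mem_range.mp hj; omega)
      _ = _ := by simp
  have hbd : ∀ ξ, ‖𝓕 g ξ‖ ≤ 144 * v * ε * (1 + ‖ξ‖) ^ (-(3 : ℝ)) := by
    intro ξ
    have h0 := hdec 0 (by norm_num) ξ
    have h3 := hdec 3 le_rfl ξ
    rw [Real.rpow_neg (by positivity), ← div_eq_mul_inv, le_div_iff₀ (by positivity)]
    norm_num at h0 h3 ⊢
    have h4 : (1 + ‖ξ‖) ^ 3 ≤ 4 * (1 + ‖ξ‖ ^ 3) := by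
      nlinarith [norm_nonneg ξ, mul_nonneg (add_nonneg zero_le_one (norm_nonneg ξ))
        (sq_nonneg (‖ξ‖ - 1))]
    have h5 : ‖𝓕 g ξ‖ * (1 + ‖ξ‖) ^ 3 ≤ ‖𝓕 g ξ‖ * (4 * (1 + ‖ξ‖ ^ 3)) := by gcongr
    nlinarith
  have hgi : Integrable g := hg.continuous.integrable_of_hasCompactSupport hcs
  have hFi : Integrable (𝓕 g) := by
    refine (hI.const_mul (144 * v * ε)).mono' ?_ (Eventually.of_forall hbd)
    exact (VectorFourier.fourierIntegral_continuous Real.continuous_fourierChar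
      continuous_inner hgi).aestronglyMeasurable
  have hneg : 𝓕⁻ g = fun ξ => 𝓕 g (-ξ) := funext fun ξ => Real.fourierInv_eq_fourier_neg g ξ
  refine ⟨𝓕⁻ g, ?_, ?_, hg.continuous.fourier_fourierInv_eq hgi hFi⟩
  · rw [hneg]; exact hFi.comp_neg
  · rw [hneg, integral_neg_eq_self (fun ξ => ‖𝓕 g ξ‖)]
    calc ∫ ξ, ‖𝓕 g ξ‖ ≤ ∫ ξ, 144 * v * ε * (1 + ‖ξ‖) ^ (-(3 : ℝ)) :=
          integral_mono hFi.norm (hI.const_mul _) hbd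
      _ = 144 * v * J * ε := by rw [integral_const_mul]; ring
      _ ≤ _ := by nlinarith

lemma norm_iteratedFDeriv_comp_smul_le {σ : Euc 2 → ℂ} (hσ : ContDiff ℝ ∞ σ) (p : Euc 2) {R : ℝ}
    (hR : 0 ≤ R) (n : ℕ) (y : Euc 2) :
    ‖iteratedFDeriv ℝ n (fun y => σ (p + R • y)) y‖ ≤
      ‖iteratedFDeriv ℝ n σ (p + R • y)‖ * R ^ n := by
  have h1 : (fun y => σ (p + R • y)) = (fun z => σ (p + z)) ∘
      (R • ContinuousLinearMap.id ℝ (Euc 2)) := by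
    ext y; simp
  have h2 : ContDiff ℝ ∞ fun z => σ (p + z) := hσ.comp (contDiff_const.add contDiff_id)
  rw [h1, ContinuousLinearMap.iteratedFDeriv_comp_right _ h2 y (by exact_mod_cast le_top),
    iteratedFDeriv_comp_add_left]
  refine (ContinuousMultilinearMap.norm_compContinuousLinearMap_le _ _).trans ?_
  simp only [Finset.prod_const, Finset.card_univ, Fintype.card_fin, norm_smul, smul_apply,
    ContinuousLinearMap.id_apply, Real.norm_eq_abs, abs_of_nonneg hR]
  gcongr
  exact mul_le_of_le_one_right hR ContinuousLinearMap.norm_id_le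

/-- Rescaling near a zero makes a smooth function small in the Wiener algebra. -/
lemma exists_rescaled_fourier_eq {σ : Euc 2 → ℂ} (hσ : ContDiff ℝ ∞ σ)
    (hs : HasCompactSupport σ) {p : Euc 2} (hp : σ p = 0) {δ : ℝ} (hδ : 0 < δ) :
    ∃ R > (0 : ℝ), ∃ b : Euc 2 → ℂ, Integrable b ∧ ∫ ξ, ‖b ξ‖ < δ ∧
      ∀ y ∈ ball (0 : Euc 2) 1, 𝓕 b y = σ (p + R • y) := by
  obtain ⟨K, hK, hW⟩ := exists_fourier_eq_of_norm_iteratedFDeriv_le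
  let χ : ContDiffBump (0 : Euc 2) := ⟨1, 2, one_pos, one_lt_two⟩
  set X : Euc 2 → ℂ := fun y => (χ y : ℂ) with hX
  have hXc : ContDiff ℝ ∞ X := Complex.ofRealCLM.contDiff.comp χ.contDiff
  have hXs : tsupport X ⊆ closedBall 0 2 := by
    refine (closure_mono ?_).trans (χ.tsupport_eq).subset
    intro y hy
    simpa [hX] using hy
  have hXcs : HasCompactSupport X := (isCompact_closedBall 0 2).of_isClosed_subset
    (isClosed_tsupport X) hXs
  obtain ⟨A, hA0, hA⟩ := exists_forall_norm_iteratedFDeriv_le hXc hXcs 3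
  obtain ⟨B, hB0, hB⟩ := exists_forall_norm_iteratedFDeriv_le hσ hs 3
  set R : ℝ := min 1 (δ / (2 * (K * (16 * A * B + 1)))) with hR
  have hR0 : 0 < R := by positivity
  have hR1 : R ≤ 1 := min_le_left _ _
  have hgc : ContDiff ℝ ∞ fun y => σ (p + R • y) :=
    hσ.comp (contDiff_const.add (contDiff_id.const_smul R))
  have hh : ∀ n ≤ 3, ∀ y ∈ closedBall (0 : Euc 2) 2,
      ‖iteratedFDeriv ℝ n (fun y => σ (p + R • y)) y‖ ≤ 2 * B * R := by
    intro n hn y hy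
    rcases Nat.eq_zero_or_pos n with rfl | hn0
    · rw [norm_iteratedFDeriv_zero]
      have h1 : ‖σ (p + R • y) - σ p‖ ≤ B * ‖p + R • y - p‖ :=
        convex_univ.norm_image_sub_le_of_norm_fderiv_le
          (fun z _ => (hσ.differentiable (by simp)) z)
          (fun z _ => by
            have := hB 1 (by norm_num) z
            rwa [norm_iteratedFDeriv_one] at this) (mem_univ p) (mem_univ _)
      rw [hp, sub_zero, add_sub_cancel_left, norm_smul, Real.norm_of_nonneg hR0.le] at h1
      have h2 : ‖y‖ ≤ 2 := by simpa using hy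
      calc _ ≤ B * (R * ‖y‖) := h1
        _ ≤ B * (R * 2) := by gcongr
        _ = _ := by ring
    · refine (norm_iteratedFDeriv_comp_smul_le hσ p hR0.le n y).trans ?_
      have h1 : R ^ n ≤ R := pow_le_of_le_one hR0.le hR1 hn0.ne'
      calc _ ≤ B * R := by gcongr; exact hB n hn _
        _ ≤ _ := by nlinarith [mul_nonneg hB0 hR0.le]
  have hgs : tsupport (fun y => X y * σ (p + R • y)) ⊆ closedBall 0 2 :=
    (tsupport_mul_subset_left).trans hXs
  have hgb : ∀ n ≤ 3, ∀ y, ‖iteratedFDeriv ℝ n (fun y => X y * σ (p + R • y)) y‖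
      ≤ 16 * A * B * R := by
    intro n hn y
    by_cases hy : y ∈ closedBall (0 : Euc 2) 2
    · refine (norm_iteratedFDeriv_mul_le hXc hgc y (n := n) (by exact_mod_cast le_top)).trans ?_
      calc _ ≤ ∑ i ∈ Finset.range (n + 1), (n.choose i : ℝ) * (A * (2 * B * R)) := by
            refine Finset.sum_le_sum fun i hi => ?_
            have hi' := Finset.mem_range.mp hi
            rw [mul_assoc]
            gcongr
            · exact hA i (by omega) y
            · exact hh (n - i) (by omega) y hy
        _ = 2 ^ n * (A * (2 * B * R)) := by
            rw [← Finset.sum_mul]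
            congr 1
            exact_mod_cast Nat.sum_range_choose n
        _ ≤ 2 ^ 3 * (A * (2 * B * R)) := by gcongr; norm_num
        _ = _ := by ring
    · have : iteratedFDeriv ℝ n (fun y => X y * σ (p + R • y)) y = 0 := by
        by_contra h
        exact hy (hgs (support_iteratedFDeriv_subset n h))
      rw [this, norm_zero]; positivity
  obtain ⟨b, hb, hbn, hbF⟩ := hW (fun y => X y * σ (p + R • y)) (16 * A * B * R)
    (hXc.mul hgc) hgs hgb
  refine ⟨R, hR0, b, hb, hbn.trans_lt ?_, fun y hy => ?_⟩
  · have h1 : R ≤ δ / (2 * (K * (16 * A * B + 1))) := min_le_right _ _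
    rw [le_div_iff₀ (by positivity)] at h1
    have h2 : 0 < K * R := by positivity
    nlinarith
  · rw [hbF]
    have : χ y = 1 := χ.one_of_mem_closedBall (ball_subset_closedBall hy)
    simp [hX, this]

lemma contDiff_of_forall_mem_tsupport {n : ℕ∞ω} {g : Euc 2 → ℂ}
    (h : ∀ x ∈ tsupport g, ContDiffAt ℝ n g x) : ContDiff ℝ n g := by
  refine contDiff_iff_contDiffAt.mpr fun x => ?_
  by_cases hx : x ∈ tsupport g
  · exact h x hx
  · exact contDiffAt_const.congr_of_eventuallyEq (notMem_tsupport_iff_eventuallyEq.mp hx)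

lemma exists_contDiff_hasCompactSupport_eventuallyEq {g : Euc 2 → ℂ} {U : Set (Euc 2)}
    (hU : IsOpen U) (hg : ContDiffOn ℝ ∞ g U) {p : Euc 2} (hp : p ∈ U) :
    ∃ σ : Euc 2 → ℂ, ContDiff ℝ ∞ σ ∧ HasCompactSupport σ ∧ σ =ᶠ[𝓝 p] g := by
  obtain ⟨r, hr, hrU⟩ := nhds_basis_closedBall.mem_iff.mp (hU.mem_nhds hp)
  let χ : ContDiffBump p := ⟨r / 2, r, half_pos hr, half_lt_self hr⟩
  have hs : tsupport (fun x => (χ x : ℂ)) ⊆ closedBall p r := by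
    refine (closure_mono ?_).trans (χ.tsupport_eq).subset
    intro y hy
    simpa using hy
  have hs' : tsupport (fun x => (χ x : ℂ) * g x) ⊆ closedBall p r :=
    (tsupport_mul_subset_left (f := fun x => (χ x : ℂ))).trans hs
  refine ⟨fun x => (χ x : ℂ) * g x, ?_, ?_, ?_⟩
  · refine contDiff_of_forall_mem_tsupport fun x hx => ?_
    exact (Complex.ofRealCLM.contDiff.comp χ.contDiff).contDiffAt.mul
      (hg.contDiffAt (hU.mem_nhds (hrU (hs' hx))))
  · exact (isCompact_closedBall p r).of_isClosed_subset (isClosed_tsupport _) hs'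
  · filter_upwards [χ.eventuallyEq_one] with x hx
    simp [hx]

lemma fderiv_comp_smul_sub {f : Euc 2 → ℂ} (hf : ContDiff ℝ 1 f) (c : ℝ) (p x : Euc 2) (j : Fin 2) :
    pd j (fun x => f (c • (x - p))) x = c * pd j f (c • (x - p)) := by
  have h1 : HasFDerivAt (fun x : Euc 2 => c • (x - p)) (c • ContinuousLinearMap.id ℝ (Euc 2)) x :=
    ((hasFDerivAt_id x).sub_const p).const_smul c
  have h2 := ((hf.differentiable one_ne_zero) (c • (x - p))).hasFDerivAt.comp x h1
  have h3 : fderiv ℝ (fun x => f (c • (x - p))) x = _ := h2.fderiv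
  rw [pd, h3]
  simp [pd]

/-- Local bi-Lipschitz solutions of the Beltrami equation `(∂₀ + μ ∂₁) f = 0`. -/
lemma exists_bilipschitz_beltrami {μ : Euc 2 → ℂ} {U : Set (Euc 2)} (hU : IsOpen U)
    (hμ : ContDiffOn ℝ ∞ μ U) {p : Euc 2} (hp : p ∈ U) (him : (μ p).im ≠ 0) :
    ∃ (f : Euc 2 → ℂ) (m M : ℝ), 0 < m ∧ ContDiff ℝ 1 f ∧
      (∀ᶠ x in 𝓝 p, pd 0 f x + μ x * pd 1 f x = 0) ∧
      ∀ x y, m * ‖x - y‖ ≤ ‖f x - f y‖ ∧ ‖f x - f y‖ ≤ M * ‖x - y‖ := by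
  obtain ⟨δ, hδ, m, hm, M, hB⟩ := exists_bilipschitz_beltrami_of_small him
  obtain ⟨σ, hσ, hσs, hσe⟩ := exists_contDiff_hasCompactSupport_eventuallyEq hU
    (g := fun x => μ x - μ p) (hμ.sub contDiffOn_const) hp
  have hσp : σ p = 0 := by rw [hσe.eq_of_nhds, sub_self]
  obtain ⟨R, hR, b, hb, hbδ, hbF⟩ := exists_rescaled_fourier_eq hσ hσs hσp hδ
  obtain ⟨f, hf, hfe, hfl⟩ := hB b hb hbδ
  refine ⟨fun x => f (R⁻¹ • (x - p)), m * R⁻¹, M * R⁻¹, by positivity, ?_, ?_, fun x y => ?_⟩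
  · exact hf.comp ((contDiff_id.sub contDiff_const).const_smul R⁻¹)
  · filter_upwards [hσe, ball_mem_nhds p hR] with x hx hxR
    rw [fderiv_comp_smul_sub hf, fderiv_comp_smul_sub hf]
    have h1 : R⁻¹ • (x - p) ∈ ball (0 : Euc 2) 1 := by
      rw [mem_ball_zero_iff, norm_smul, norm_inv, Real.norm_of_nonneg hR.le, inv_mul_lt_iff₀ hR,
        mul_one]
      exact mem_ball_iff_norm.mp hxR
    have h2 := hbF _ h1
    rw [smul_inv_smul₀ hR.ne', add_sub_cancel, hx] at h2
    have h3 := hfe (R⁻¹ • (x - p))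
    rw [h2] at h3
    linear_combination ((R⁻¹ : ℝ) : ℂ) * h3
  · have h1 : ‖R⁻¹ • (x - p) - R⁻¹ • (y - p)‖ = R⁻¹ * ‖x - y‖ := by
      rw [← smul_sub, sub_sub_sub_cancel_right, norm_smul, Real.norm_of_nonneg (by positivity)]
    have h2 := hfl (R⁻¹ • (x - p)) (R⁻¹ • (y - p))
    rw [h1] at h2
    constructor
    · linarith [h2.1]
    · linarith [h2.2]

/-- The complex first-order operator `∂₀ + μ ∂₁` in the plane. -/
def beltramiOp (μ : Euc 2 → ℂ) (g : Euc 2 → ℂ) (x : Euc 2) : ℂ := pd 0 g x + μ x * pd 1 g x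

section beltramiOp

variable {μ f g : Euc 2 → ℂ} {x : Euc 2}

lemma beltramiOp_mul (hf : DifferentiableAt ℝ f x) (hg : DifferentiableAt ℝ g x) :
    beltramiOp μ (fun y => f y * g y) x = f x * beltramiOp μ g x + g x * beltramiOp μ f x := by
  simp only [beltramiOp, pd, fderiv_fun_mul hf hg, add_apply, smul_apply, smul_eq_mul]
  ring

lemma beltramiOp_sub_const (a : ℂ) :
    beltramiOp μ (fun y => f y - a) x = beltramiOp μ f x := by
  simp only [beltramiOp, pd, fderiv_sub_const]

lemma beltramiOp_const (a : ℂ) : beltramiOp μ (fun _ => a) x = 0 := by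
  simp [beltramiOp, pd]

lemma beltramiOp_congr (h : f =ᶠ[𝓝 x] g) : beltramiOp μ f x = beltramiOp μ g x := by
  simp only [beltramiOp, pd, h.fderiv_eq]

lemma beltramiOp_cube (hf : DifferentiableAt ℝ f x) :
    beltramiOp μ (fun y => f y ^ 3) x = 3 * f x ^ 2 * beltramiOp μ f x := by
  have e : (fun y => f y ^ 3) = fun y => f y * (f y * f y) := by ext y; ring
  rw [e, beltramiOp_mul hf (hf.fun_mul hf), beltramiOp_mul hf hf]
  ring

lemma beltramiOp_finset_prod_sub (s : Finset (Euc 2)) (hf : ContDiff ℝ 1 f)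
    (h : beltramiOp μ f x = 0) : beltramiOp μ (fun y => ∏ z ∈ s, (f y - f z)) x = 0 := by
  classical
  induction s using Finset.induction_on with
  | empty => simpa using beltramiOp_const 1
  | insert z s hz ih =>
    simp only [Finset.prod_insert hz]
    rw [beltramiOp_mul ((hf.differentiable one_ne_zero x).sub_const _)
      ((contDiff_prod fun i _ => hf.sub contDiff_const).differentiable one_ne_zero x), ih,
      beltramiOp_sub_const, h]
    ring

end beltramiOp

lemma contDiffAt_cube_div {φ w : Euc 2 → ℂ} {z : Euc 2} (hφ : ContDiffAt ℝ 1 φ z)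
    (hw : ContDiffAt ℝ 1 w z) (hz : φ z = 0) {c : ℝ} (hc : 0 < c)
    (hcw : ∀ᶠ x in 𝓝 z, c * ‖x - z‖ ≤ ‖w x‖) : ContDiffAt ℝ 1 (fun x => φ x ^ 3 / w x) z := by
  obtain ⟨φ', u, hu, hφ'c, hφ'⟩ := contDiffAt_one_iff.mp hφ
  obtain ⟨w', v, hv, hw'c, hw'⟩ := contDiffAt_one_iff.mp hw
  -- the quotient `φ / w` stays bounded
  obtain ⟨B, hB0, hB'⟩ := (hφ' z (mem_of_mem_nhds hu)).isBigO_sub.exists_nonneg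
  have hB : ∀ᶠ x in 𝓝 z, ‖φ x‖ ≤ B * ‖x - z‖ := by simpa [hz] using hB'.bound
  have hA : ∀ᶠ x in 𝓝 z, ‖φ x / w x‖ ≤ B / c := by
    filter_upwards [hB, hcw] with x hx hxc
    rcases eq_or_ne x z with rfl | hne
    · rw [hz, zero_div, norm_zero]; positivity
    · have h0 : 0 < ‖x - z‖ := norm_pos_iff.mpr (sub_ne_zero.mpr hne)
      rw [norm_div, div_le_div_iff₀ (lt_of_lt_of_le (by positivity) hxc) hc]
      nlinarith
  set A := B / c with hAdef
  obtain ⟨t, ht, hto, hzt⟩ :=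
    _root_.mem_nhds_iff.mp (inter_mem (inter_mem hu hv) (inter_mem hcw hA))
  have hw0 : ∀ x ∈ t, x ≠ z → w x ≠ 0 := fun x hx hne h => by
    have := (ht hx).2.1
    have h0 : 0 < ‖x - z‖ := norm_pos_iff.mpr (sub_ne_zero.mpr hne)
    simp only [Set.mem_ofPred_eq, h, norm_zero] at this
    nlinarith
  set D : Euc 2 → (Euc 2 →L[ℝ] ℂ) := fun x =>
    (3 * φ x * (φ x / w x)) • φ' x - (φ x * (φ x / w x) ^ 2) • w' x with hD
  refine contDiffAt_one_iff.mpr ⟨D, t, hto.mem_nhds hzt, fun x hx => ?_, fun x hx => ?_⟩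
  · have hφx := hφ' x (ht hx).1.1
    have hwx := hw' x (ht hx).1.2
    have hφ'x : ContinuousAt φ' x :=
      hφ'c.continuousAt (mem_of_superset (hto.mem_nhds hx) fun y hy => (ht hy).1.1)
    have hw'x : ContinuousAt w' x :=
      hw'c.continuousAt (mem_of_superset (hto.mem_nhds hx) fun y hy => (ht hy).1.2)
    refine ContinuousAt.continuousWithinAt ?_
    rcases eq_or_ne x z with rfl | hne
    · have hD0 : D x = 0 := by simp [hD, hz]
      rw [ContinuousAt, hD0]
      have hlim : Tendsto (fun y => ‖φ y‖ * (3 * A * ‖φ' y‖ + A ^ 2 * ‖w' y‖)) (𝓝 x) (𝓝 0) := by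
        have : ContinuousAt (fun y => ‖φ y‖ * (3 * A * ‖φ' y‖ + A ^ 2 * ‖w' y‖)) x :=
          hφx.continuousAt.norm.mul ((hφ'x.norm.const_mul _).add (hw'x.norm.const_mul _))
        rw [ContinuousAt, hz, norm_zero, zero_mul] at this
        exact this
      refine squeeze_zero_norm' ?_ hlim
      filter_upwards [hA] with y hy
      refine (norm_sub_le _ _).trans ?_
      rw [norm_smul, norm_smul, norm_mul, norm_mul, norm_mul, norm_pow, Complex.norm_ofNat]
      have h1 : ‖φ y‖ * ‖φ y / w y‖ ^ 2 * ‖w' y‖ ≤ ‖φ y‖ * A ^ 2 * ‖w' y‖ := by gcongr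
      have h2 : 3 * ‖φ y‖ * ‖φ y / w y‖ * ‖φ' y‖ ≤ 3 * ‖φ y‖ * A * ‖φ' y‖ := by gcongr
      linarith
    · have hq : ContinuousAt (fun y => φ y / w y) x :=
        hφx.continuousAt.div hwx.continuousAt (hw0 x hx hne)
      exact (((hφx.continuousAt.const_mul 3).mul hq).smul hφ'x).sub
        ((hφx.continuousAt.mul (hq.pow 2)).smul hw'x)
  · have hφx := hφ' x (ht hx).1.1
    have hwx := hw' x (ht hx).1.2
    rcases eq_or_ne x z with rfl | hne
    · have hD0 : D x = 0 := by simp [hD, hz]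
      rw [hD0]
      refine Asymptotics.IsBigO.hasFDerivAt (n := 2) ?_ one_lt_two
      refine Asymptotics.IsBigO.of_bound (B ^ 2 * A) ?_
      filter_upwards [hA, hB] with y hy1 hy2
      have e : φ y ^ 3 / w y = φ y ^ 2 * (φ y / w y) := by ring
      rw [e, norm_mul, norm_pow, norm_pow, norm_norm]
      calc ‖φ y‖ ^ 2 * ‖φ y / w y‖ ≤ (B * ‖y - x‖) ^ 2 * A := by gcongr
        _ = _ := by ring
    · have h0 := hw0 x hx hne
      have h1 := (hφx.pow 3).mul ((hasFDerivAt_inv' (𝕜 := ℝ) h0).comp x hwx)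
      refine (h1.congr_fderiv ?_).congr_of_eventuallyEq
        (Eventually.of_forall fun y => div_eq_mul_inv _ _)
      ext v
      simp [hD]
      field_simp
      ring

/-- A product `∏ (f x - f z)` of differences vanishes at most linearly at its nodes, when `f` is
expanding. -/
lemma exists_mul_norm_sub_le_norm_finset_prod_sub {f : Euc 2 → ℂ} (hf : Continuous f) {m : ℝ}
    (hm : 0 < m) (hfm : ∀ x y, m * ‖x - y‖ ≤ ‖f x - f y‖) {s : Finset (Euc 2)} {z : Euc 2}
    (hz : z ∈ s) :
    ∃ c > 0, ∀ᶠ x in 𝓝 z, c * ‖x - z‖ ≤ ‖∏ y ∈ s, (f x - f y)‖ := by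
  classical
  set w : Euc 2 → ℂ := fun x => ∏ y ∈ s.erase z, (f x - f y) with hw
  have hwc : Continuous w := by fun_prop
  have hwz : 0 < ‖w z‖ := by
    refine norm_pos_iff.mpr (Finset.prod_ne_zero_iff.mpr fun y hy h => ?_)
    have h1 := hfm z y
    have h2 : 0 < ‖z - y‖ := norm_pos_iff.mpr (sub_ne_zero.mpr (Finset.ne_of_mem_erase hy).symm)
    rw [h, norm_zero] at h1
    nlinarith
  refine ⟨m * (‖w z‖ / 2), by positivity, ?_⟩
  filter_upwards [hwc.norm.continuousAt.eventually_const_le (half_lt_self hwz)] with x hx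
  rw [← Finset.mul_prod_erase s _ hz, norm_mul]
  calc m * (‖w z‖ / 2) * ‖x - z‖ = (m * ‖x - z‖) * (‖w z‖ / 2) := by ring
    _ ≤ _ := mul_le_mul (hfm x z) hx (by positivity) (norm_nonneg _)

lemma finset_prod_sub_ne_zero {f : Euc 2 → ℂ} {m : ℝ} (hm : 0 < m)
    (hfm : ∀ x y, m * ‖x - y‖ ≤ ‖f x - f y‖) {s : Finset (Euc 2)} {x : Euc 2} (hx : x ∉ s) :
    ∏ y ∈ s, (f x - f y) ≠ 0 := by
  refine Finset.prod_ne_zero_iff.mpr fun y hy h => ?_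
  have h1 := hfm x y
  have h2 : 0 < ‖x - y‖ := norm_pos_iff.mpr (sub_ne_zero.mpr fun e => hx (e ▸ hy))
  rw [h, norm_zero] at h1
  nlinarith

lemma contDiffAt_cube_div_finset_prod_sub {f φ : Euc 2 → ℂ} (hf : ContDiff ℝ 1 f) {m : ℝ}
    (hm : 0 < m) (hfm : ∀ x y, m * ‖x - y‖ ≤ ‖f x - f y‖) {s : Finset (Euc 2)}
    (hs : ∀ z ∈ s, φ z = 0) {x : Euc 2} (hφ : ContDiffAt ℝ 1 φ x) :
    ContDiffAt ℝ 1 (fun y => φ y ^ 3 / ∏ z ∈ s, (f y - f z)) x := by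
  have hP : ContDiff ℝ 1 fun y => ∏ z ∈ s, (f y - f z) :=
    contDiff_prod fun i _ => hf.sub contDiff_const
  by_cases hx : x ∈ s
  · obtain ⟨c, hc, h⟩ := exists_mul_norm_sub_le_norm_finset_prod_sub hf.continuous hm hfm hx
    exact contDiffAt_cube_div hφ hP.contDiffAt (hs x hx) hc h
  · simp only [div_eq_mul_inv]
    exact (hφ.pow 3).mul (hP.contDiffAt.inv (finset_prod_sub_ne_zero hm hfm hx))

lemma differentiableAt_cube_div {φ P : Euc 2 → ℂ} {x : Euc 2} (hφ : DifferentiableAt ℝ φ x)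
    (hP : DifferentiableAt ℝ P x) (h0 : P x ≠ 0) :
    DifferentiableAt ℝ (fun y => φ y ^ 3 / P y) x := by
  simp only [div_eq_mul_inv]
  exact (hφ.fun_pow 3).fun_mul (hP.fun_inv h0)

lemma beltramiOp_cube_div {μ φ P : Euc 2 → ℂ} {x : Euc 2} (hφ : DifferentiableAt ℝ φ x)
    (hP : DifferentiableAt ℝ P x) (h0 : P x ≠ 0) (h : beltramiOp μ P x = 0) :
    beltramiOp μ (fun y => φ y ^ 3 / P y) x = 3 * φ x ^ 2 * beltramiOp μ φ x / P x := by
  have hg : DifferentiableAt ℝ (fun y => φ y ^ 3 / P y) x :=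
    differentiableAt_cube_div hφ hP h0
  have e : (fun y => φ y ^ 3) =ᶠ[𝓝 x] fun y => φ y ^ 3 / P y * P y := by
    filter_upwards [hP.continuousAt.eventually_ne h0] with y hy
    rw [div_mul_cancel₀ _ hy]
  have h1 := beltramiOp_congr (μ := μ) e
  rw [beltramiOp_cube hφ, beltramiOp_mul hg hP, h, mul_zero, zero_add] at h1
  rw [h1, mul_div_cancel_left₀ _ h0]

lemma norm_sq_beltramiOp_cutoff_le {μ χ P : Euc 2 → ℂ} {φ : Fin 2 → Euc 2 → ℂ} {x : Euc 2}
    {C : ℝ} (hC : 0 ≤ C) (hφ : ∀ i, DifferentiableAt ℝ (φ i) x) (hχ : DifferentiableAt ℝ χ x)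
    (hP : DifferentiableAt ℝ P x) (h0 : P x ≠ 0) (h : beltramiOp μ P x = 0)
    (hle : ∀ i, ‖beltramiOp μ (φ i) x‖ ≤ C * (‖φ 0 x‖ + ‖φ 1 x‖)) (i : Fin 2) :
    ‖beltramiOp μ (fun y => χ y * (φ i y ^ 3 / P y)) x‖ ^ 2 ≤
      144 * C ^ 2 * (‖χ x * (φ 0 x ^ 3 / P x)‖ ^ 2 + ‖χ x * (φ 1 x ^ 3 / P x)‖ ^ 2) +
        2 * (‖φ i x ^ 3 * beltramiOp μ χ x‖ ^ 2 / ‖P x‖ ^ 2) := by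
  rw [beltramiOp_mul hχ (differentiableAt_cube_div (hφ i) hP h0), beltramiOp_cube_div (hφ i) hP h0
    h]
  set A := χ x * (3 * φ i x ^ 2 * beltramiOp μ (φ i) x / P x) with hA
  set B := φ i x ^ 3 / P x * beltramiOp μ χ x with hB
  have hBn : ‖B‖ ^ 2 = ‖φ i x ^ 3 * beltramiOp μ χ x‖ ^ 2 / ‖P x‖ ^ 2 := by
    rw [hB, ← div_pow, ← norm_div]; congr 2; ring
  have hAn : ‖A‖ ≤ 6 * C * (‖χ x * (φ 0 x ^ 3 / P x)‖ + ‖χ x * (φ 1 x ^ 3 / P x)‖) := by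
    have key : ∀ {a b c : ℝ}, 0 ≤ a → 0 ≤ b → (c = a ∨ c = b) →
        c ^ 2 * (a + b) ≤ 2 * (a ^ 3 + b ^ 3) := by
      rintro a b c ha hb (rfl | rfl)
      · nlinarith [mul_nonneg (add_nonneg ha hb) (sq_nonneg (c - b)), pow_nonneg ha 3,
            pow_nonneg hb 3, mul_nonneg hb (sq_nonneg (c - b)), mul_nonneg ha (sq_nonneg (c - b))]
      · nlinarith [mul_nonneg (add_nonneg ha hb) (sq_nonneg (a - c)), pow_nonneg ha 3,
            pow_nonneg hb 3, mul_nonneg hb (sq_nonneg (a - c)), mul_nonneg ha (sq_nonneg (a - c))]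
    have hi : ‖φ i x‖ = ‖φ 0 x‖ ∨ ‖φ i x‖ = ‖φ 1 x‖ := by fin_cases i <;> simp
    have h1 := key (norm_nonneg (φ 0 x)) (norm_nonneg (φ 1 x)) hi
    simp only [hA, norm_mul, norm_div, norm_pow, Complex.norm_ofNat]
    calc ‖χ x‖ * (3 * ‖φ i x‖ ^ 2 * ‖beltramiOp μ (φ i) x‖ / ‖P x‖)
        ≤ ‖χ x‖ * (3 * ‖φ i x‖ ^ 2 * (C * (‖φ 0 x‖ + ‖φ 1 x‖)) / ‖P x‖) := by
          gcongr; exact hle i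
      _ = 3 * C * ‖χ x‖ / ‖P x‖ * (‖φ i x‖ ^ 2 * (‖φ 0 x‖ + ‖φ 1 x‖)) := by ring
      _ ≤ 3 * C * ‖χ x‖ / ‖P x‖ * (2 * (‖φ 0 x‖ ^ 3 + ‖φ 1 x‖ ^ 3)) := by gcongr
      _ = _ := by ring
  rw [← hBn]
  set a := ‖χ x * (φ 0 x ^ 3 / P x)‖
  set b := ‖χ x * (φ 1 x ^ 3 / P x)‖
  have h2 : ‖A + B‖ ^ 2 ≤ 2 * ‖A‖ ^ 2 + 2 * ‖B‖ ^ 2 := by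
    nlinarith [norm_add_le A B, norm_nonneg (A + B), sq_nonneg (‖A‖ - ‖B‖)]
  have h3 : ‖A‖ ^ 2 ≤ 72 * C ^ 2 * (a ^ 2 + b ^ 2) := by
    calc ‖A‖ ^ 2 ≤ (6 * C * (a + b)) ^ 2 := by gcongr
      _ ≤ _ := by nlinarith [mul_nonneg (sq_nonneg C) (sq_nonneg (a - b))]
  linarith

lemma sum_integral_norm_sq_cutoff_le {μ χ P : Euc 2 → ℂ} {φ ψ : Fin 2 → Euc 2 → ℂ} {p : Euc 2}
    {R r C D E : ℝ} {μ₀ : ℂ} (hC : 0 ≤ C) (hD : 0 < D) (hE : 0 ≤ E)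
    (hμ₀ : μ₀.im ≠ 0) (hμ : ∀ x ∈ closedBall p r, ‖μ x - μ₀‖ ≤ |μ₀.im| / 2)
    (hφ : ∀ i, ∀ x ∈ closedBall p r, DifferentiableAt ℝ (φ i) x)
    (hle : ∀ i, ∀ x ∈ closedBall p r, ‖beltramiOp μ (φ i) x‖ ≤ C * (‖φ 0 x‖ + ‖φ 1 x‖))
    (hχ : Differentiable ℝ χ) (hχ1 : ∀ x ∈ ball p R, χ x = 1)
    (hχE : ∀ i, ∀ x ∈ closedBall p r, ‖φ i x ^ 3 * beltramiOp μ χ x‖ ^ 2 ≤ E)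
    (hP : Differentiable ℝ P) (hP0 : ∀ x ∈ closedBall p r, beltramiOp μ P x = 0)
    (hPae : ∀ᵐ x, P x ≠ 0) (hPD : ∀ x ∉ ball p R, D ≤ ‖P x‖)
    (hψ : ∀ i x, ψ i x = χ x * (φ i x ^ 3 / P x)) (hψd : ∀ i, ContDiff ℝ 1 (ψ i))
    (hψs : ∀ i, tsupport (ψ i) ⊆ closedBall p r)
    (hsmall : 2 * (16 * r ^ 2 / μ₀.im ^ 2) * (144 * C ^ 2) ≤ 1 / 2) :
    (∫ x, ‖ψ 0 x‖ ^ 2) + ∫ x, ‖ψ 1 x‖ ^ 2 ≤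
      8 * (16 * r ^ 2 / μ₀.im ^ 2) * E * volume.real (closedBall p r) / D ^ 2 := by
  have hψI : ∀ i, Integrable fun x => ‖ψ i x‖ ^ 2 := fun i => by
    have hc : HasCompactSupport (ψ i) :=
      (isCompact_closedBall p r).of_isClosed_subset (isClosed_tsupport _) (hψs i)
    exact Continuous.integrable_of_hasCompactSupport ((hψd i).continuous.norm.pow 2)
      (hc.comp_left (g := fun z : ℂ => ‖z‖ ^ 2) (by simp))
  set G : Euc 2 → ℝ := fun x => 144 * C ^ 2 * (‖ψ 0 x‖ ^ 2 + ‖ψ 1 x‖ ^ 2) +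
    (closedBall p r).indicator (fun _ => 2 * (E / D ^ 2)) x with hG
  have hI1 : Integrable fun x => 144 * C ^ 2 * (‖ψ 0 x‖ ^ 2 + ‖ψ 1 x‖ ^ 2) :=
    ((hψI 0).add (hψI 1)).const_mul _
  have hI2 : Integrable ((closedBall p r).indicator fun _ => 2 * (E / D ^ 2)) :=
    (integrable_indicator_iff measurableSet_closedBall).mpr
      (integrableOn_const measure_closedBall_lt_top.ne)
  have hGI : Integrable G := hI1.add hI2
  have hGle : ∀ i, ∀ᵐ x, ‖pd 0 (ψ i) x + μ x * pd 1 (ψ i) x‖ ^ 2 ≤ G x := fun i => by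
    filter_upwards [hPae] with x h0
    change ‖beltramiOp μ (ψ i) x‖ ^ 2 ≤ _
    by_cases hxB : x ∈ closedBall p r
    · rw [show ψ i = fun y => χ y * (φ i y ^ 3 / P y) from funext (hψ i)]
      refine (norm_sq_beltramiOp_cutoff_le hC (fun i => hφ i x hxB) (hχ x) (hP x) h0
        (hP0 x hxB) (fun i => hle i x hxB) i).trans ?_
      simp only [hG, Set.indicator_of_mem hxB, ← hψ]
      refine add_le_add le_rfl (mul_le_mul_of_nonneg_left ?_ zero_le_two)
      by_cases hxR : x ∈ ball p R
      · have : beltramiOp μ χ x = 0 := by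
          rw [beltramiOp_congr (g := fun _ => 1), beltramiOp_const]
          filter_upwards [isOpen_ball.mem_nhds hxR] with y hy using hχ1 y hy
        rw [this, mul_zero, norm_zero, zero_pow two_ne_zero, zero_div]
        positivity
      · exact div_le_div₀ hE (hχE i x hxB) (by positivity)
          (pow_le_pow_left₀ hD.le (hPD x hxR) 2)
    · have h0 : ψ i =ᶠ[𝓝 x] fun _ => 0 :=
        notMem_tsupport_iff_eventuallyEq.mp fun h => hxB (hψs i h)
      rw [beltramiOp_congr h0, beltramiOp_const, norm_zero, zero_pow two_ne_zero]
      simp only [hG, Set.indicator_of_notMem hxB, add_zero]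
      positivity
  have hGv : ∫ x, G x = 144 * C ^ 2 * ((∫ x, ‖ψ 0 x‖ ^ 2) + ∫ x, ‖ψ 1 x‖ ^ 2) +
      volume.real (closedBall p r) * (2 * (E / D ^ 2)) := by
    simp only [hG]
    rw [integral_add hI1 hI2, integral_const_mul, integral_add (hψI 0) (hψI 1),
      integral_indicator measurableSet_closedBall, setIntegral_const, smul_eq_mul]
  have hmain := fun i =>
    integral_norm_sq_le_of_norm_sq_pd_add_le (hψd i) (hψs i) hμ₀ hμ hGI (hGle i)
  rw [hGv] at hmain
  have h0 := hmain 0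
  have h1 := hmain 1
  have hS : 0 ≤ (∫ x, ‖ψ 0 x‖ ^ 2) + ∫ x, ‖ψ 1 x‖ ^ 2 :=
    add_nonneg (integral_nonneg fun x => by positivity) (integral_nonneg fun x => by positivity)
  clear hmain hGv hGle hGI hI1 hI2 hψI
  generalize ∫ x, ‖ψ 0 x‖ ^ 2 = S₀ at *
  generalize ∫ x, ‖ψ 1 x‖ ^ 2 = S₁ at *
  generalize volume.real (closedBall p r) = V at *
  generalize 16 * r ^ 2 / μ₀.im ^ 2 = K at *
  have h3 := mul_le_mul_of_nonneg_right hsmall hS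
  rw [show 8 * K * E * V / D ^ 2 = 8 * K * V * (E / D ^ 2) by ring]
  linarith

/-- A Carleman-type estimate: solutions of `|(∂₀ + μ ∂₁) φ| ≤ C |φ|` with many zeros close to `p`
are small near `p`. -/
lemma setIntegral_norm_pow_six_le {μ f χ : Euc 2 → ℂ} {φ : Fin 2 → Euc 2 → ℂ} {p : Euc 2}
    {R C m M E : ℝ} {μ₀ : ℂ} (hC : 0 ≤ C) (hm : 0 < m) (hE : 0 ≤ E)
    (hμ₀ : μ₀.im ≠ 0) (hμ : ∀ x ∈ closedBall p (2 * R), ‖μ x - μ₀‖ ≤ |μ₀.im| / 2)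
    (hf : ContDiff ℝ 1 f) (hf0 : ∀ x ∈ closedBall p (2 * R), beltramiOp μ f x = 0)
    (hfm : ∀ x y, m * ‖x - y‖ ≤ ‖f x - f y‖) (hfM : ∀ x y, ‖f x - f y‖ ≤ M * ‖x - y‖)
    (hφ : ∀ i, ∀ x ∈ closedBall p (2 * R), ContDiffAt ℝ 1 (φ i) x)
    (hle : ∀ i, ∀ x ∈ closedBall p (2 * R),
      ‖beltramiOp μ (φ i) x‖ ≤ C * (‖φ 0 x‖ + ‖φ 1 x‖))
    (hχ : ContDiff ℝ 1 χ) (hχs : tsupport χ ⊆ closedBall p (2 * R))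
    (hχ1 : ∀ x ∈ ball p R, χ x = 1)
    (hχE : ∀ i, ∀ x ∈ closedBall p (2 * R), ‖φ i x ^ 3 * beltramiOp μ χ x‖ ^ 2 ≤ E)
    (hsmall : 2 * (16 * (2 * R) ^ 2 / μ₀.im ^ 2) * (144 * C ^ 2) ≤ 1 / 2)
    {ρ : ℝ} (hρR : ρ < R) {s : Finset (Euc 2)} (hs : ↑s ⊆ ball p ρ)
    (hs0 : ∀ i, ∀ z ∈ s, φ i z = 0) (i : Fin 2) :
    ∫ x in ball p ρ, ‖φ i x‖ ^ 6 ≤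
      8 * (16 * (2 * R) ^ 2 / μ₀.im ^ 2) * E * volume.real (closedBall p (2 * R)) *
        (2 * M * ρ / (m * (R - ρ))) ^ (2 * s.card) := by
  rcases le_or_gt ρ 0 with hρ | hρ
  · rw [ball_eq_empty.mpr hρ, setIntegral_empty]
    have : 0 ≤ volume.real (closedBall p (2 * R)) := measureReal_nonneg
    rw [pow_mul]
    positivity
  have hM : 0 < M := by
    have h1 := (hfm (EuclideanSpace.single 0 1) 0).trans (hfM (EuclideanSpace.single 0 1) 0)
    simp only [sub_zero, PiLp.norm_single, norm_one, mul_one] at h1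
    linarith
  set P : Euc 2 → ℂ := fun x => ∏ z ∈ s, (f x - f z) with hP
  set ψ : Fin 2 → Euc 2 → ℂ := fun i x => χ x * (φ i x ^ 3 / P x) with hψ
  set D : ℝ := (m * (R - ρ)) ^ s.card with hD
  have hRρ : 0 < R - ρ := sub_pos.mpr hρR
  have hD0 : 0 < D := by positivity
  have hPd : ContDiff ℝ 1 P := contDiff_prod fun i _ => hf.sub contDiff_const
  have hPD : ∀ x ∉ ball p R, D ≤ ‖P x‖ := fun x hx => by
    simp only [hP, norm_prod, hD, ← Finset.prod_const]
    refine Finset.prod_le_prod (fun _ _ => by positivity) fun z hz => ?_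
    refine le_trans ?_ (hfm x z)
    have h1 := mem_ball.mp (hs hz)
    have h2 : R ≤ dist x p := by simpa using hx
    have h3 := dist_triangle x z p
    rw [dist_eq_norm x z] at h3
    gcongr
    linarith
  have hPM : ∀ x ∈ ball p ρ, ‖P x‖ ≤ (2 * M * ρ) ^ s.card := fun x hx => by
    simp only [hP, norm_prod, ← Finset.prod_const]
    refine Finset.prod_le_prod (fun _ _ => norm_nonneg _) fun z hz => (hfM x z).trans ?_
    have h1 := mem_ball.mp (hs hz)
    have h2 := mem_ball.mp hx
    have h3 := dist_triangle_right x z p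
    rw [dist_eq_norm x z] at h3
    nlinarith
  have hψs : ∀ i, tsupport (ψ i) ⊆ closedBall p (2 * R) := fun i =>
    (tsupport_mul_subset_left (f := χ) (g := fun x => φ i x ^ 3 / P x)).trans hχs
  have hψd : ∀ i, ContDiff ℝ 1 (ψ i) := fun i =>
    contDiff_of_forall_mem_tsupport fun x hx => hχ.contDiffAt.mul
      (contDiffAt_cube_div_finset_prod_sub hf hm hfm (hs0 i) (hφ i x (hψs i hx)))
  have hψc : ∀ i, HasCompactSupport (ψ i) := fun i =>
    (isCompact_closedBall p (2 * R)).of_isClosed_subset (isClosed_tsupport _) (hψs i)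
  have hψI : ∀ i, Integrable fun x => ‖ψ i x‖ ^ 2 := fun i =>
    Continuous.integrable_of_hasCompactSupport ((hψd i).continuous.norm.pow 2)
      ((hψc i).comp_left (g := fun z : ℂ => ‖z‖ ^ 2) (by simp))
  have hPae : ∀ᵐ x, P x ≠ 0 := by
    filter_upwards [compl_mem_ae_iff.mpr (s.finite_toSet.measure_zero volume)] with x hx
    exact finset_prod_sub_ne_zero hm hfm hx
  have hS := sum_integral_norm_sq_cutoff_le hC hD0 hE hμ₀ hμ
    (fun i x hx => (hφ i x hx).differentiableAt one_ne_zero) hle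
    (hχ.differentiable one_ne_zero) hχ1 hχE (hPd.differentiable one_ne_zero)
    (fun x hx => beltramiOp_finset_prod_sub s hf (hf0 x hx)) hPae hPD (fun _ _ => rfl) hψd hψs
    hsmall
  set K := 16 * (2 * R) ^ 2 / μ₀.im ^ 2
  set V := volume.real (closedBall p (2 * R))
  have hiS : ∫ x, ‖ψ i x‖ ^ 2 ≤ 8 * K * E * V / D ^ 2 := by
    have h0 : ∀ i, 0 ≤ ∫ x, ‖ψ i x‖ ^ 2 := fun i => integral_nonneg fun x => by positivity
    refine le_trans ?_ hS
    fin_cases i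
    · exact le_add_of_nonneg_right (h0 1)
    · exact le_add_of_nonneg_left (h0 0)
  have hpt : ∀ x ∈ ball p ρ, ‖φ i x‖ ^ 6 ≤ ((2 * M * ρ) ^ s.card) ^ 2 * ‖ψ i x‖ ^ 2 :=
    fun x hx => by
      by_cases hxs : x ∈ s
      · rw [hs0 i x hxs, norm_zero, zero_pow (by norm_num)]
        positivity
      · have h1 : φ i x ^ 3 = P x * ψ i x := by
          rw [hψ]
          beta_reduce
          rw [hχ1 x (ball_subset_ball hρR.le hx), one_mul,
            mul_div_cancel₀ _ (finset_prod_sub_ne_zero hm hfm hxs)]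
        calc ‖φ i x‖ ^ 6 = ‖φ i x ^ 3‖ ^ 2 := by rw [norm_pow]; ring
          _ = ‖P x‖ ^ 2 * ‖ψ i x‖ ^ 2 := by rw [h1, norm_mul, mul_pow]
          _ ≤ _ := by gcongr; exact hPM x hx
  calc ∫ x in ball p ρ, ‖φ i x‖ ^ 6
      ≤ ∫ x in ball p ρ, ((2 * M * ρ) ^ s.card) ^ 2 * ‖ψ i x‖ ^ 2 := by
        refine integral_mono_of_nonneg (Eventually.of_forall fun x => by positivity)
          ((hψI i).const_mul _).integrableOn ?_
        filter_upwards [ae_restrict_mem measurableSet_ball] with x hx using hpt x hx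
    _ ≤ ∫ x, ((2 * M * ρ) ^ s.card) ^ 2 * ‖ψ i x‖ ^ 2 :=
        setIntegral_le_integral ((hψI i).const_mul _) (Eventually.of_forall fun x => by positivity)
    _ = ((2 * M * ρ) ^ s.card) ^ 2 * ∫ x, ‖ψ i x‖ ^ 2 := integral_const_mul _ _
    _ ≤ ((2 * M * ρ) ^ s.card) ^ 2 * (8 * K * E * V / D ^ 2) := by
        gcongr
    _ = _ := by
        rw [hD, div_pow, pow_mul' _ 2, pow_mul' _ 2]
        ring

/-- Strong unique continuation from an accumulation point of zeros, for pairs of functions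
satisfying a first-order elliptic differential inequality in the plane. -/
theorem eventually_eq_zero_of_frequently_eq_zero {μ : Euc 2 → ℂ} {U : Set (Euc 2)}
    (hU : IsOpen U) (hμ : ContDiffOn ℝ ∞ μ U) {p : Euc 2} (hp : p ∈ U) (him : (μ p).im ≠ 0)
    {φ : Fin 2 → Euc 2 → ℂ} (hφ : ∀ i, ContDiffOn ℝ 1 (φ i) U) {C : ℝ} (hC : 0 ≤ C)
    (hle : ∀ i, ∀ᶠ x in 𝓝 p, ‖beltramiOp μ (φ i) x‖ ≤ C * (‖φ 0 x‖ + ‖φ 1 x‖))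
    (hz : ∃ᶠ x in 𝓝[≠] p, ∀ i, φ i x = 0) : ∀ᶠ x in 𝓝 p, ∀ i, φ i x = 0 := by
  obtain ⟨f, m, M, hm, hf, hf0, hfb⟩ := exists_bilipschitz_beltrami hU hμ hp him
  have hμp : ContinuousAt μ p := hμ.continuousOn.continuousAt (hU.mem_nhds hp)
  have hev : ∀ᶠ x in 𝓝 p, x ∈ U ∧ ‖μ x - μ p‖ ≤ |(μ p).im| / 2 ∧ beltramiOp μ f x = 0 ∧
      ∀ i, ‖beltramiOp μ (φ i) x‖ ≤ C * (‖φ 0 x‖ + ‖φ 1 x‖) := by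
    refine (hU.eventually_mem hp).and (Eventually.and ?_ (hf0.and (eventually_all.mpr hle)))
    have h1 : ContinuousAt (fun x => ‖μ x - μ p‖) p := (hμp.sub continuousAt_const).norm
    refine h1.eventually_le_const ?_
    simp only [sub_self, norm_zero]
    positivity
  obtain ⟨ε, hε, hεB⟩ := Metric.nhds_basis_closedBall.eventually_iff.mp hev
  obtain ⟨R, ⟨hRε, hsmall⟩, hR⟩ : ∃ R : ℝ, (2 * R ≤ ε ∧
      2 * (16 * (2 * R) ^ 2 / (μ p).im ^ 2) * (144 * C ^ 2) ≤ 1 / 2) ∧ R ∈ Ioi 0 := by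
    refine (((Eventually.and ?_ ?_).filter_mono nhdsWithin_le_nhds).and
      self_mem_nhdsWithin : ∀ᶠ R : ℝ in 𝓝[>] 0, _).exists
    · have : ContinuousAt (fun R : ℝ => 2 * R) 0 := by fun_prop
      exact this.eventually_le_const (by simpa using hε)
    · have : ContinuousAt (fun R : ℝ =>
        2 * (16 * (2 * R) ^ 2 / (μ p).im ^ 2) * (144 * C ^ 2)) 0 := by fun_prop
      exact this.eventually_le_const (by norm_num)
  rw [mem_Ioi] at hR
  have hB : ∀ x ∈ closedBall p (2 * R), _ := fun x hx => hεB (closedBall_subset_closedBall hRε hx)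
  obtain ⟨ρ, ⟨hρR, hρ1⟩, hρ⟩ : ∃ ρ : ℝ, (ρ < R ∧ (2 * M * ρ / (m * (R - ρ))) ^ 2 < 1) ∧
      ρ ∈ Ioi 0 := by
    refine (((Eventually.and ?_ ?_).filter_mono nhdsWithin_le_nhds).and
      self_mem_nhdsWithin : ∀ᶠ ρ : ℝ in 𝓝[>] 0, _).exists
    · exact eventually_lt_nhds hR
    · have : ContinuousAt (fun ρ : ℝ => (2 * M * ρ / (m * (R - ρ))) ^ 2) 0 := by
        refine ContinuousAt.pow (ContinuousAt.div (by fun_prop) (by fun_prop) ?_) 2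
        rw [sub_zero]
        positivity
      exact this.eventually_lt_const (by simp)
  rw [mem_Ioi] at hρ
  let b : ContDiffBump p := ⟨R, 2 * R, hR, by linarith⟩
  set χ : Euc 2 → ℂ := fun x => (b x : ℂ) with hχ
  have hχd : ContDiff ℝ 1 χ := Complex.ofRealCLM.contDiff.comp b.contDiff
  have hχs : tsupport χ ⊆ closedBall p (2 * R) := by
    rw [← b.tsupport_eq]
    exact closure_mono fun x hx h => hx (by simp [hχ, h])
  have hχ1 : ∀ x ∈ ball p R, χ x = 1 := fun x hx => by
    simp only [hχ]
    rw [b.one_of_mem_closedBall (ball_subset_closedBall hx), Complex.ofReal_one]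
  have hBU : closedBall p (2 * R) ⊆ U := fun x hx => (hB x hx).1
  have hE : ∀ i, ∃ E, ∀ x ∈ closedBall p (2 * R), ‖‖φ i x ^ 3 * beltramiOp μ χ x‖ ^ 2‖ ≤ E :=
    fun i => by
      refine (isCompact_closedBall p (2 * R)).exists_bound_of_continuousOn ?_
      have h0 := (continuous_pd hχd 0).continuousOn (s := closedBall p (2 * R))
      have h1 := (continuous_pd hχd 1).continuousOn (s := closedBall p (2 * R))
      exact ((((hφ i).continuousOn.mono hBU).pow 3).mul
        (h0.add ((hμ.continuousOn.mono hBU).mul h1))).norm.pow 2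
  choose E hE using hE
  have hEE : ∀ i, ∀ x ∈ closedBall p (2 * R),
      ‖φ i x ^ 3 * beltramiOp μ χ x‖ ^ 2 ≤ |E 0| + |E 1| := fun i x hx => by
    refine ((le_abs_self _).trans (hE i x hx)).trans ((le_abs_self _).trans ?_)
    fin_cases i
    · exact le_add_of_nonneg_right (abs_nonneg _)
    · exact le_add_of_nonneg_left (abs_nonneg _)
  have hT : {x | x ∈ ball p ρ ∧ ∀ i, φ i x = 0}.Infinite := by
    refine Set.Infinite.of_accPt (x := p) (accPt_iff_frequently_nhdsNE.mpr ?_)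
    refine (hz.and_eventually (mem_nhdsWithin_of_mem_nhds (ball_mem_nhds p hρ))).mono ?_
    exact fun x hx => ⟨hx.2, hx.1⟩
  set Q := 8 * (16 * (2 * R) ^ 2 / (μ p).im ^ 2) * (|E 0| + |E 1|) *
    volume.real (closedBall p (2 * R))
  have hkey : ∀ (i : Fin 2) (N : ℕ), ∫ x in ball p ρ, ‖φ i x‖ ^ 6 ≤
      Q * ((2 * M * ρ / (m * (R - ρ))) ^ 2) ^ N := fun i N => by
    obtain ⟨s, hs, hcard⟩ := hT.exists_subset_card_eq N
    rw [← pow_mul, ← hcard]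
    exact setIntegral_norm_pow_six_le hC hm (by positivity) him (fun x hx => (hB x hx).2.1) hf
      (fun x hx => (hB x hx).2.2.1) (fun x y => (hfb x y).1) (fun x y => (hfb x y).2)
      (fun i x hx => (hφ i).contDiffAt (hU.mem_nhds (hBU hx))) (fun i x hx => (hB x hx).2.2.2 i)
      hχd hχs hχ1 hEE hsmall hρR (fun x hx => (hs hx).1) (fun i z hz => (hs hz).2 i) i
  have hzero : ∀ i, EqOn (φ i) (fun _ => 0) (ball p ρ) := fun i => by
    have hc : ContinuousOn (φ i) (closedBall p ρ) := (hφ i).continuousOn.mono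
      ((closedBall_subset_closedBall (by linarith)).trans hBU)
    have h1 : ∫ x in ball p ρ, ‖φ i x‖ ^ 6 = 0 := by
      refine le_antisymm ?_ (integral_nonneg fun x => by positivity)
      have := (tendsto_pow_atTop_nhds_zero_of_lt_one (sq_nonneg _) hρ1).const_mul Q
      rw [mul_zero] at this
      exact ge_of_tendsto' this (hkey i)
    have hintg : IntegrableOn (fun x => ‖φ i x‖ ^ 6) (ball p ρ) :=
      ((hc.norm.pow 6).integrableOn_compact (isCompact_closedBall p ρ)).mono_set
        ball_subset_closedBall
    rw [setIntegral_eq_zero_iff_of_nonneg_ae (Eventually.of_forall fun x => by positivity)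
      hintg] at h1
    refine Measure.eqOn_open_of_ae_eq (μ := volume) ?_ isOpen_ball
      (hc.mono ball_subset_closedBall) continuousOn_const
    filter_upwards [h1] with x hx
    simpa using hx
  filter_upwards [ball_mem_nhds p hρ] with x hx i using hzero i hx

lemma beltramiOp_beltramiOp {μ κ v : Euc 2 → ℂ} {x : Euc 2} (hv : ContDiffAt ℝ 2 v x)
    (hκ : DifferentiableAt ℝ κ x) :
    beltramiOp μ (beltramiOp κ v) x = pd 0 (pd 0 v) x + (κ x + μ x) * pd 0 (pd 1 v) x +
      κ x * μ x * pd 1 (pd 1 v) x + beltramiOp μ κ x * pd 1 v x := by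
  have hd : DifferentiableAt ℝ (fderiv ℝ v) x :=
    (hv.fderiv_right (m := 1) le_rfl).differentiableAt one_ne_zero
  have hpd : ∀ j, DifferentiableAt ℝ (pd j v) x := fun j =>
    hd.clm_apply (differentiableAt_const _)
  have hsymm : pd 1 (pd 0 v) x = pd 0 (pd 1 v) x := by
    have h := (hv.isSymmSndFDerivAt (by simp)).eq (EuclideanSpace.single 1 1)
      (EuclideanSpace.single 0 1)
    have e : ∀ i j : Fin 2, pd i (pd j v) x =
        fderiv ℝ (fderiv ℝ v) x (EuclideanSpace.single i 1) (EuclideanSpace.single j 1) :=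
      fun i j => by
        simp only [pd]
        rw [fderiv_clm_apply hd (differentiableAt_const _)]
        simp
    rw [e, e, h]
  have h1 : ∀ j, pd j (beltramiOp κ v) x =
      pd j (pd 0 v) x + (κ x * pd j (pd 1 v) x + pd j κ x * pd 1 v x) := fun j => by
    have : beltramiOp κ v = fun y => pd 0 v y + κ y * pd 1 v y := rfl
    rw [this]
    change fderiv ℝ _ x _ = _
    rw [fderiv_fun_add (hpd 0) (hκ.fun_mul (hpd 1)), fderiv_fun_mul hκ (hpd 1)]
    simp only [add_apply, smul_apply, smul_eq_mul]
    ring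
  rw [beltramiOp, h1, h1, hsymm, beltramiOp]
  ring

lemma pd_ofReal {u : Euc 2 → ℝ} {x : Euc 2} (hu : DifferentiableAt ℝ u x) (j : Fin 2) :
    pd j (fun y => (u y : ℂ)) x = (fderiv ℝ u x (EuclideanSpace.single j 1) : ℝ) := by
  have := (Complex.ofRealCLM.hasFDerivAt.comp x hu.hasFDerivAt).fderiv
  simp only [pd]
  rw [show (fun y => (u y : ℂ)) = Complex.ofRealCLM ∘ u from rfl, this]
  rfl

lemma pd_pd_ofReal {u : Euc 2 → ℝ} {x : Euc 2} (hu : ContDiffAt ℝ 2 u x) (i j : Fin 2) :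
    pd i (pd j fun y => (u y : ℂ)) x =
      (iteratedFDeriv ℝ 2 u x ![EuclideanSpace.single i 1, EuclideanSpace.single j 1] : ℝ) := by
  have hd : DifferentiableAt ℝ (fderiv ℝ u) x :=
    (hu.fderiv_right (m := 1) le_rfl).differentiableAt one_ne_zero
  have e : (pd j fun y => (u y : ℂ)) =ᶠ[𝓝 x]
      fun y => ((fderiv ℝ u y (EuclideanSpace.single j 1) : ℝ) : ℂ) := by
    filter_upwards [(hu.of_le one_le_two).eventually (by simp)] with y hy
    exact pd_ofReal (hy.differentiableAt one_ne_zero) j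
  rw [pd, e.fderiv_eq]
  change pd i _ x = _
  rw [pd_ofReal (hd.clm_apply (differentiableAt_const _)), iteratedFDeriv_two_apply,
    fderiv_clm_apply hd (differentiableAt_const _)]
  simp

lemma gradient_apply_eq (u : Euc 2 → ℝ) (x : Euc 2) (j : Fin 2) :
    gradient u x j = fderiv ℝ u x (EuclideanSpace.single j 1) := by
  have h := EuclideanSpace.inner_single_right j (1 : ℝ) (gradient u x)
  rw [inner_gradient_left] at h
  simpa using h.symm

lemma exists_abs_le_mul_of_zero_section {F : Euc 2 → ℝ → Euc 2 → ℝ} {p : Euc 2}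
    (hF : ContDiffAt ℝ 1 (fun q : Euc 2 × ℝ × Euc 2 => F q.1 q.2.1 q.2.2) (p, 0, 0))
    (hF0 : ∀ᶠ x in 𝓝 p, F x 0 0 = 0) :
    ∃ K : ℝ, 0 ≤ K ∧ ∀ᶠ q : Euc 2 × ℝ × Euc 2 in 𝓝 (p, 0, 0),
      |F q.1 q.2.1 q.2.2| ≤ K * (|q.2.1| + ‖q.2.2‖) := by
  obtain ⟨K, t, ht, hK⟩ := hF.exists_lipschitzOnWith
  refine ⟨K, K.2, ?_⟩
  have h1 : Tendsto (fun q : Euc 2 × ℝ × Euc 2 => (q.1, (0 : ℝ), (0 : Euc 2))) (𝓝 (p, 0, 0))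
      (𝓝 (p, 0, 0)) := Continuous.tendsto' (by fun_prop) _ _ rfl
  have h2 : Tendsto (fun q : Euc 2 × ℝ × Euc 2 => q.1) (𝓝 (p, 0, 0)) (𝓝 p) :=
    Continuous.tendsto' (by fun_prop) _ _ rfl
  filter_upwards [ht, h1 ht, h2.eventually hF0] with q hq hq0 hqF
  have h := hK.dist_le_mul _ hq _ hq0
  simp only [hqF, Real.dist_eq, sub_zero] at h
  refine h.trans (mul_le_mul_of_nonneg_left ?_ K.2)
  rw [Prod.dist_eq, Prod.dist_eq, dist_self]
  simp only [dist_zero_right, Real.norm_eq_abs]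
  exact max_le (by positivity) (max_le (le_add_of_nonneg_right (norm_nonneg _))
    (le_add_of_nonneg_left (abs_nonneg _)))

lemma elliptic_pos_and_det_pos {a : Fin 2 → Fin 2 → ℝ} (hsym : ∀ i j, a i j = a j i)
    (hpos : ∀ ξ : Euc 2, ξ ≠ 0 → 0 < ∑ i, ∑ j, a i j * ξ i * ξ j) :
    0 < a 0 0 ∧ 0 < a 0 0 * a 1 1 - a 0 1 ^ 2 := by
  have h0 : 0 < a 0 0 := by
    have := hpos !₂[1, 0] (fun h => by simpa using congrArg (fun v : Euc 2 => v 0) h)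
    simpa [Fin.sum_univ_two] using this
  refine ⟨h0, ?_⟩
  have h1 := hpos !₂[-a 0 1, a 0 0] (fun h => h0.ne' (by
    simpa using congrArg (fun v : Euc 2 => v 1) h))
  simp only [Fin.sum_univ_two, hsym 1 0] at h1
  simp at h1
  nlinarith

/-- The characteristic coefficient `μ` for which `∂₀ + μ ∂₁` divides the principal part
`∑ a_{ij} ∂ᵢ∂ⱼ`. -/
def charCoeff (a : Fin 2 → Fin 2 → Euc 2 → ℝ) (x : Euc 2) : ℂ :=
  ((a 0 1 x / a 0 0 x : ℝ) : ℂ) +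
    ((√(a 0 0 x * a 1 1 x - a 0 1 x ^ 2) / a 0 0 x : ℝ) : ℂ) * Complex.I

section charCoeff

variable {a : Fin 2 → Fin 2 → Euc 2 → ℝ} {x : Euc 2}

lemma charCoeff_re : (charCoeff a x).re = a 0 1 x / a 0 0 x := by
  simp [charCoeff, -Complex.ofReal_div]

lemma charCoeff_im :
    (charCoeff a x).im = √(a 0 0 x * a 1 1 x - a 0 1 x ^ 2) / a 0 0 x := by
  simp [charCoeff, -Complex.ofReal_div]

lemma conj_charCoeff_add (h0 : 0 < a 0 0 x) :
    (a 0 0 x : ℂ) * (conj (charCoeff a x) + charCoeff a x) = 2 * a 0 1 x := by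
  rw [add_comm, Complex.add_conj, charCoeff_re]
  push_cast
  have : (a 0 0 x : ℂ) ≠ 0 := by exact_mod_cast h0.ne'
  field_simp

lemma conj_charCoeff_mul (h0 : 0 < a 0 0 x) (h1 : 0 < a 0 0 x * a 1 1 x - a 0 1 x ^ 2) :
    (a 0 0 x : ℂ) * (conj (charCoeff a x) * charCoeff a x) = a 1 1 x := by
  rw [mul_comm (conj _), Complex.mul_conj, Complex.normSq_apply, charCoeff_re, charCoeff_im]
  norm_cast
  have := Real.mul_self_sqrt h1.le
  field_simp
  nlinarith

lemma contDiffOn_charCoeff {U : Set (Euc 2)} (ha : ∀ i j, ContDiffOn ℝ ∞ (a i j) U)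
    (h0 : ∀ x ∈ U, 0 < a 0 0 x) (h1 : ∀ x ∈ U, 0 < a 0 0 x * a 1 1 x - a 0 1 x ^ 2) :
    ContDiffOn ℝ ∞ (charCoeff a) U := by
  have h := ((((ha 0 0).mul (ha 1 1)).sub ((ha 0 1).pow 2)).sqrt fun x hx => (h1 x hx).ne').div
    (ha 0 0) fun x hx => (h0 x hx).ne'
  have h' := (ha 0 1).div (ha 0 0) fun x hx => (h0 x hx).ne'
  exact (Complex.ofRealCLM.contDiff.comp_contDiffOn h').add
    ((Complex.ofRealCLM.contDiff.comp_contDiffOn h).mul contDiffOn_const)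

end charCoeff

/-- The two first-order operators factor the second-order operator up to a first-order term. -/
lemma beltramiOp_charCoeff_eq {a : Fin 2 → Fin 2 → Euc 2 → ℝ} {F : Euc 2 → ℝ → Euc 2 → ℝ}
    {u : Euc 2 → ℝ} {x : Euc 2} (hsym : a 1 0 x = a 0 1 x) (h0 : 0 < a 0 0 x)
    (h1 : 0 < a 0 0 x * a 1 1 x - a 0 1 x ^ 2) (hu : ContDiffAt ℝ 2 u x)
    (hκ : DifferentiableAt ℝ (fun y => conj (charCoeff a y)) x) (heq : scalarOp a F u x = 0) :
    beltramiOp (charCoeff a) (beltramiOp (fun y => conj (charCoeff a y)) fun y => (u y : ℂ)) x =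
      ((F x (u x) (gradient u x) / a 0 0 x : ℝ) : ℂ) +
        beltramiOp (charCoeff a) (fun y => conj (charCoeff a y)) x *
          pd 1 (fun y => (u y : ℂ)) x := by
  have hv : ContDiffAt ℝ 2 (fun y => (u y : ℂ)) x := Complex.ofRealCLM.contDiff.contDiffAt.comp x hu
  have ha : (a 0 0 x : ℂ) ≠ 0 := by exact_mod_cast h0.ne'
  have hs : iteratedFDeriv ℝ 2 u x ![EuclideanSpace.single 1 1, EuclideanSpace.single 0 1] =
      iteratedFDeriv ℝ 2 u x ![EuclideanSpace.single 0 1, EuclideanSpace.single 1 1] := by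
    simp only [iteratedFDeriv_two_apply, Matrix.cons_val_zero, Matrix.cons_val_one]
    exact (hu.isSymmSndFDerivAt (by simp)).eq _ _
  simp only [scalarOp, Fin.sum_univ_two, hs, hsym] at heq
  rw [beltramiOp_beltramiOp hv hκ]
  simp only [pd_pd_ofReal hu]
  generalize iteratedFDeriv ℝ 2 u x
    ![EuclideanSpace.single 0 1, EuclideanSpace.single 0 1] = u00 at *
  generalize iteratedFDeriv ℝ 2 u x
    ![EuclideanSpace.single 0 1, EuclideanSpace.single 1 1] = u01 at *
  generalize iteratedFDeriv ℝ 2 u x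
    ![EuclideanSpace.single 1 1, EuclideanSpace.single 1 1] = u11 at *
  congr 1
  have e : F x (u x) (gradient u x) = a 0 0 x * u00 + 2 * a 0 1 x * u01 + a 1 1 x * u11 := by
    linarith
  rw [e, Complex.ofReal_div, eq_div_iff ha]
  push_cast
  linear_combination (u01 : ℂ) * conj_charCoeff_add h0 + (u11 : ℂ) * conj_charCoeff_mul h0 h1

lemma abs_fderiv_single_le_norm_gradient (u : Euc 2 → ℝ) (x : Euc 2) (j : Fin 2) :
    |fderiv ℝ u x (EuclideanSpace.single j 1)| ≤ ‖gradient u x‖ := by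
  rw [← gradient_apply_eq, ← Real.norm_eq_abs]
  exact PiLp.norm_apply_le _ _

lemma norm_gradient_le_add (u : Euc 2 → ℝ) (x : Euc 2) :
    ‖gradient u x‖ ≤ |fderiv ℝ u x (EuclideanSpace.single 0 1)| +
      |fderiv ℝ u x (EuclideanSpace.single 1 1)| := by
  rw [← gradient_apply_eq, ← gradient_apply_eq, EuclideanSpace.norm_eq, Fin.sum_univ_two,
    Real.norm_eq_abs, Real.norm_eq_abs]
  refine Real.sqrt_le_iff.mpr ⟨by positivity, ?_⟩
  nlinarith [mul_nonneg (abs_nonneg (gradient u x 0)) (abs_nonneg (gradient u x 1))]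

lemma norm_gradient_le_mul_norm_beltramiOp {μ : Euc 2 → ℂ} {u : Euc 2 → ℝ} {x : Euc 2}
    (hu : DifferentiableAt ℝ u x) (him : (μ x).im ≠ 0) :
    ‖gradient u x‖ ≤ (1 + (‖μ x‖ + 1) / |(μ x).im|) *
      ‖beltramiOp (fun y => conj (μ y)) (fun y => (u y : ℂ)) x‖ := by
  refine (norm_gradient_le_add u x).trans ?_
  rw [beltramiOp, pd_ofReal hu, pd_ofReal hu]
  set d₀ := fderiv ℝ u x (EuclideanSpace.single 0 1)
  set d₁ := fderiv ℝ u x (EuclideanSpace.single 1 1)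
  set w : ℂ := d₀ + conj (μ x) * d₁ with hw
  have hi : 0 < |(μ x).im| := abs_pos.mpr him
  have h1 : |d₁| ≤ ‖w‖ / |(μ x).im| := by
    rw [le_div_iff₀ hi, ← abs_mul]
    refine le_trans (le_of_eq ?_) (Complex.abs_im_le_norm w)
    simp [hw, mul_comm]
  have h0 : |d₀| ≤ ‖w‖ + ‖μ x‖ * |d₁| := by
    have e : (d₀ : ℂ) = w - conj (μ x) * d₁ := by rw [hw]; ring
    calc |d₀| = ‖(d₀ : ℂ)‖ := by simp
      _ ≤ ‖w‖ + ‖conj (μ x) * d₁‖ := by rw [e]; exact norm_sub_le _ _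
      _ = _ := by simp
  have h2 : ‖μ x‖ * |d₁| ≤ ‖μ x‖ * (‖w‖ / |(μ x).im|) := by gcongr
  calc |d₀| + |d₁| ≤ ‖w‖ + ‖μ x‖ * (‖w‖ / |(μ x).im|) + ‖w‖ / |(μ x).im| := by linarith
    _ = _ := by ring

lemma norm_beltramiOp_ofReal {μ : Euc 2 → ℂ} {u : Euc 2 → ℝ} {x : Euc 2}
    (hu : DifferentiableAt ℝ u x) :
    ‖beltramiOp μ (fun y => (u y : ℂ)) x‖ =
      ‖beltramiOp (fun y => conj (μ y)) (fun y => (u y : ℂ)) x‖ := by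
  rw [← RCLike.norm_conj]
  simp only [beltramiOp, pd_ofReal hu, map_add, map_mul, Complex.conj_ofReal]

/-- A solution of the second-order equation vanishes near every accumulation point of its critical
nodal set. -/
theorem eventually_eq_zero_of_frequently_critical {U : Set (Euc 2)} (hU : IsOpen U)
    {a : Fin 2 → Fin 2 → Euc 2 → ℝ} (ha : ∀ i j, ContDiffOn ℝ ∞ (a i j) U)
    (hsym : ∀ i j, ∀ x ∈ U, a i j x = a j i x)
    (hpos : ∀ x ∈ U, ∀ ξ : Euc 2, ξ ≠ 0 → 0 < ∑ i, ∑ j, a i j x * ξ i * ξ j)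
    {F : Euc 2 → ℝ → Euc 2 → ℝ}
    (hF : ContDiffOn ℝ ∞ (fun p : Euc 2 × ℝ × Euc 2 => F p.1 p.2.1 p.2.2)
      (U ×ˢ (univ : Set (ℝ × Euc 2))))
    (hF0 : ∀ x ∈ U, F x 0 0 = 0) {u : Euc 2 → ℝ} (hu : ContDiffOn ℝ ∞ u U)
    (heq : ∀ x ∈ U, scalarOp a F u x = 0) {p : Euc 2} (hp : p ∈ U) (hup : u p = 0)
    (hgp : gradient u p = 0) (hz : ∃ᶠ x in 𝓝[≠] p, u x = 0 ∧ gradient u x = 0) :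
    ∀ᶠ x in 𝓝 p, u x = 0 := by
  have hpU : ∀ᶠ x in 𝓝 p, x ∈ U := hU.mem_nhds hp
  have hell := fun x hx => elliptic_pos_and_det_pos (fun i j => hsym i j x hx) (hpos x hx)
  set μ := charCoeff a with hμdef
  have hμ : ContDiffOn ℝ ∞ μ U :=
    contDiffOn_charCoeff ha (fun x hx => (hell x hx).1) fun x hx => (hell x hx).2
  have him : ∀ x ∈ U, (μ x).im ≠ 0 := fun x hx => by
    rw [hμdef, charCoeff_im]
    exact (div_pos (Real.sqrt_pos.mpr (hell x hx).2) (hell x hx).1).ne'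
  set κ : Euc 2 → ℂ := fun y => conj (μ y) with hκdef
  have hκ : ContDiffOn ℝ ∞ κ U := Complex.conjCLE.contDiff.comp_contDiffOn hμ
  set v : Euc 2 → ℂ := fun y => (u y : ℂ) with hvdef
  have hv : ContDiffOn ℝ ∞ v U := Complex.ofRealCLM.contDiff.comp_contDiffOn hu
  have hpd : ∀ {g : Euc 2 → ℂ}, ContDiffOn ℝ ∞ g U → ∀ j, ContDiffOn ℝ 1 (pd j g) U :=
    fun hg j => (hg.fderiv_of_isOpen hU (m := 1) (by norm_cast)).clm_apply contDiffOn_const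
  have hw : ContDiffOn ℝ 1 (beltramiOp κ v) U :=
    (hpd hv 0).add ((hκ.of_le (by norm_cast)).mul (hpd hv 1))
  have hud : ∀ x ∈ U, DifferentiableAt ℝ u x := fun x hx =>
    (hu.contDiffAt (hU.mem_nhds hx)).differentiableAt (by simp)
  have hgc : ContinuousAt (gradient u) p :=
    (InnerProductSpace.toDual ℝ (Euc 2)).symm.continuous.continuousAt.comp
      ((hu.continuousOn_fderiv_of_isOpen hU (by norm_cast)).continuousAt (hU.mem_nhds hp))
  have huc : ContinuousAt u p := (hud p hp).continuousAt
  obtain ⟨K, hK, hKF⟩ := exists_abs_le_mul_of_zero_section (F := F) (p := p)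
    ((hF.contDiffAt ((hU.prod isOpen_univ).mem_nhds ⟨hp, mem_univ _⟩)).of_le (by norm_cast))
    (hpU.mono hF0)
  have hFle : ∀ᶠ x in 𝓝 p, |F x (u x) (gradient u x)| ≤ K * (|u x| + ‖gradient u x‖) := by
    have ht : Tendsto (fun x => (x, u x, gradient u x)) (𝓝 p) (𝓝 (p, 0, 0)) := by
      have := continuousAt_id.prodMk (huc.prodMk hgc)
      rwa [ContinuousAt, hup, hgp] at this
    exact ht.eventually hKF
  set B : Euc 2 → ℝ := fun x => 1 + (‖μ x‖ + 1) / |(μ x).im| with hB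
  set c : Euc 2 → ℝ := fun x => K / a 0 0 x + (K / a 0 0 x + ‖beltramiOp μ κ x‖) * B x + 1 with hc
  have hcp : ContinuousAt c p := by
    have hμc : ContinuousAt μ p := hμ.continuousOn.continuousAt (hU.mem_nhds hp)
    have h1 : ContinuousAt (beltramiOp μ κ) p :=
      (((hpd hκ 0).continuousOn.add (hμ.continuousOn.mul (hpd hκ 1).continuousOn))).continuousAt
        (hU.mem_nhds hp)
    have h2 : ContinuousAt (fun x => K / a 0 0 x) p := continuousAt_const.div
      ((ha 0 0).continuousOn.continuousAt (hU.mem_nhds hp)) (hell p hp).1.ne'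
    have h3 : ContinuousAt B p := continuousAt_const.add ((hμc.norm.add continuousAt_const).div
      (Complex.continuous_im.continuousAt.comp hμc).abs (abs_pos.mpr (him p hp)).ne')
    exact (h2.add ((h2.add h1.norm).mul h3)).add continuousAt_const
  have hce : ∀ᶠ x in 𝓝 p, c x ≤ c p + 1 := hcp.eventually_le_const (lt_add_one _)
  have hcx : ∀ x ∈ U, 1 ≤ c x := fun x hx => by
    have := (hell x hx).1
    exact le_add_of_nonneg_left (by positivity)
  have hzero := eventually_eq_zero_of_frequently_eq_zero hU hμ hp (him p hp)
    (φ := ![beltramiOp κ v, v]) (C := c p + 1) ?_ (by linarith [hcx p hp]) ?_ ?_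
  · filter_upwards [hzero] with x hx
    simpa [hvdef] using hx 1
  · intro i
    fin_cases i
    · exact hw
    · exact hv.of_le (by norm_cast)
  · intro i
    filter_upwards [hpU, hce, hFle] with x hx hcx' hFx
    have ha0 := (hell x hx).1
    have hvx : ‖v x‖ = |u x| := by simp [hvdef]
    refine le_trans ?_ (mul_le_mul_of_nonneg_right hcx' (by positivity))
    have hgrad := norm_gradient_le_mul_norm_beltramiOp (hud x hx) (him x hx)
    change ‖gradient u x‖ ≤ B x * ‖beltramiOp κ v x‖ at hgrad
    have hBx : 0 ≤ B x := by positivity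
    fin_cases i
    · change ‖beltramiOp μ (beltramiOp κ v) x‖ ≤ c x * (‖beltramiOp κ v x‖ + ‖v x‖)
      rw [beltramiOp_charCoeff_eq (hsym 1 0 x hx) ha0 (hell x hx).2
        ((hu.contDiffAt (hU.mem_nhds hx)).of_le (by norm_cast))
        ((hκ.contDiffAt (hU.mem_nhds hx)).differentiableAt (by simp)) (heq x hx)]
      have h1 : ‖pd 1 v x‖ ≤ ‖gradient u x‖ := by
        rw [pd_ofReal (hud x hx), Complex.norm_real]
        exact abs_fderiv_single_le_norm_gradient u x 1
      refine (norm_add_le _ _).trans ?_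
      rw [norm_mul, Complex.norm_real, Real.norm_eq_abs, abs_div, abs_of_pos ha0]
      calc |F x (u x) (gradient u x)| / a 0 0 x + ‖beltramiOp μ κ x‖ * ‖pd 1 v x‖
          ≤ K * (|u x| + ‖gradient u x‖) / a 0 0 x + ‖beltramiOp μ κ x‖ * ‖gradient u x‖ := by
            gcongr
        _ = K / a 0 0 x * ‖v x‖ + (K / a 0 0 x + ‖beltramiOp μ κ x‖) * ‖gradient u x‖ := by
            rw [hvx]; ring
        _ ≤ K / a 0 0 x * ‖v x‖ +
            (K / a 0 0 x + ‖beltramiOp μ κ x‖) * (B x * ‖beltramiOp κ v x‖) := by gcongr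
        _ ≤ c x * ‖v x‖ + c x * ‖beltramiOp κ v x‖ := by
            have hb : 0 ≤ (K / a 0 0 x + ‖beltramiOp μ κ x‖) * B x := by positivity
            have ha' : 0 ≤ K / a 0 0 x := by positivity
            rw [← mul_assoc]
            gcongr
            · simp only [hc]; linarith
            · simp only [hc]; linarith
        _ = _ := by ring
    · change ‖beltramiOp μ v x‖ ≤ c x * (‖beltramiOp κ v x‖ + ‖v x‖)
      rw [norm_beltramiOp_ofReal (hud x hx)]
      change ‖beltramiOp κ v x‖ ≤ _
      nlinarith [hcx x hx, norm_nonneg (beltramiOp κ v x), norm_nonneg (v x)]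
  · refine (hz.and_eventually (mem_nhdsWithin_of_mem_nhds hpU)).mono ?_
    rintro x ⟨⟨hx0, hxg⟩, hxU⟩ i
    fin_cases i
    · change beltramiOp κ v x = 0
      simp [beltramiOp, hvdef, pd_ofReal (hud x hxU), ← gradient_apply_eq, hxg]
    · change v x = 0
      simp [hvdef, hx0]

/-- For a nontrivial smooth solution `u` of a scalar semilinear elliptic
second-order equation respecting the zero section on an open connected `U ⊆ ℝ²`, the
critical nodal set `N_crit(u) = {u = 0, ∇u = 0}` is discrete: each of its points is
isolated in `N_crit(u)`. -/
theorem critical_nodal_set_discrete_dim_two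
    (U : Set (Euc 2)) (hUopen : IsOpen U) (hUconn : IsConnected U)
    (a : Fin 2 → Fin 2 → Euc 2 → ℝ)
    (ha : ∀ i j, ContDiffOn ℝ (⊤ : ℕ∞) (a i j) U)
    (hsym : ∀ i j, ∀ x ∈ U, a i j x = a j i x)
    (hpos : ∀ x ∈ U, ∀ ξ : Euc 2, ξ ≠ 0 → 0 < ∑ i, ∑ j, a i j x * ξ i * ξ j)
    (F : Euc 2 → ℝ → Euc 2 → ℝ)
    (hF : ContDiffOn ℝ (⊤ : ℕ∞) (fun p : Euc 2 × ℝ × Euc 2 => F p.1 p.2.1 p.2.2)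
      (U ×ˢ (univ : Set (ℝ × Euc 2))))
    (hF0 : ∀ x ∈ U, F x 0 0 = 0)
    (u : Euc 2 → ℝ) (hu : ContDiffOn ℝ (⊤ : ℕ∞) u U)
    (heq : ∀ x ∈ U, scalarOp a F u x = 0)
    (hnontriv : ∃ x ∈ U, u x ≠ 0) :
    ∀ p ∈ U, u p = 0 → gradient u p = 0 →
      ∃ ε > 0, {x ∈ U | u x = 0 ∧ gradient u x = 0} ∩ ball p ε = {p} := by
  set S : Set (Euc 2) := {x | ∀ᶠ y in 𝓝 x, u y = 0} with hS
  have hSopen : IsOpen S := isOpen_setOfPred_eventually_nhds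
  have hScrit : ∀ x ∈ S, u x = 0 ∧ gradient u x = 0 := fun x hx => by
    have h : u =ᶠ[𝓝 x] fun _ => 0 := hx
    refine ⟨h.eq_of_nhds, ?_⟩
    rw [gradient, h.fderiv_eq]
    simp
  have hlocal := fun x hx => eventually_eq_zero_of_frequently_critical hUopen ha hsym hpos hF hF0
    hu heq (p := x) hx
  have hclosed : closure S ∩ U ⊆ S := by
    rintro x ⟨hxS, hxU⟩
    have hfr := mem_closure_iff_frequently.mp hxS
    have huc : ContinuousAt u x := hu.continuousOn.continuousAt (hUopen.mem_nhds hxU)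
    have hgc : ContinuousAt (gradient u) x :=
      (InnerProductSpace.toDual ℝ (Euc 2)).symm.continuous.continuousAt.comp
        ((hu.continuousOn_fderiv_of_isOpen hUopen (by norm_cast)).continuousAt
          (hUopen.mem_nhds hxU))
    by_contra hx
    refine hx (hlocal x hxU ?_ ?_ ?_)
    · by_contra h
      exact hfr ((huc.eventually_ne h).mono fun y hy hyS => hy (hScrit y hyS).1)
    · by_contra h
      exact hfr ((hgc.eventually_ne h).mono fun y hy hyS => hy (hScrit y hyS).2)
    · rw [frequently_nhdsWithin_iff]
      exact hfr.mono fun y hy => ⟨hScrit y hy, fun h => hx (h ▸ hy)⟩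
  intro p hp hup hgp
  have hpS : p ∉ S := fun hpS => by
    obtain ⟨x, hxU, hx⟩ := hnontriv
    exact hx (hScrit x (hUconn.isPreconnected.subset_of_closure_inter_subset hSopen
      ⟨p, hp, hpS⟩ hclosed hxU)).1
  have hiso : ∀ᶠ x in 𝓝[≠] p, ¬ (u x = 0 ∧ gradient u x = 0) :=
    not_frequently.mp fun h => hpS (hlocal p hp hup hgp h)
  obtain ⟨ε, hε, hball⟩ := Metric.eventually_nhds_iff_ball.mp (eventually_nhdsWithin_iff.mp hiso)
  refine ⟨ε, hε, Set.eq_singleton_iff_unique_mem.mpr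
    ⟨⟨⟨hp, hup, hgp⟩, mem_ball_self hε⟩, fun x hx => ?_⟩⟩
  by_contra hne
  exact hball x hx.2 hne hx.1.2
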